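/- arXiv:math/0309418 — 6 statements merged into one kernel-verified Lean document; each statement's English description precedes it below -/
import Mathlib

section
/- Let n ≥ 1. For all homogeneous matrices X₁, …, X_{4n+2} in osp(1,2n), one has 𝒜_{4n+2}(X₁,…,X_{4n+2}) = 0 (the super Amitsur–Levitzki theorem for osp(1,2n)). -/
open Matrix

/-- Index type for the ℤ₂-graded space ℂ^p ⊕ ℂ^q. -/
abbrev Idx (p q : ℕ) := Sum (Fin p) (Fin q)

/-- Parity of a basis index. -/
def ipar {p q : ℕ} : Idx p q → ZMod 2
  | Sum.inl _ => 0
  | Sum.inr _ => 1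

/-- `(-1)^a` for `a : ZMod 2`. -/
noncomputable def sgn (a : ZMod 2) : ℂ := if a = 1 then -1 else 1

/-- A matrix is homogeneous of parity `ε` iff it maps the graded piece of
parity `a` into the piece of parity `a + ε`; equivalently, its entry `X i j`
vanishes unless `ipar i = ipar j + ε`. -/
def HasParity {p q : ℕ} (X : Matrix (Idx p q) (Idx p q) ℂ) (ε : ZMod 2) : Prop :=
  ∀ i j, ipar i ≠ ipar j + ε → X i j = 0

/-- A vector is homogeneous of parity `ε`. -/
def VHasParity {p q : ℕ} (u : Idx p q → ℂ) (ε : ZMod 2) : Prop :=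
  ∀ i, ipar i ≠ ε → u i = 0

/-- The super sign `ε(σ, 𝒳) = (-1)^{K(σ,𝒳)}`, where `K(σ,𝒳)` is the number of
pairs `(i,j)` with `i < j`, `σ i > σ j` and both `X (σ i)`, `X (σ j)` odd
(here only the parities `px` of the `X`'s matter). -/
noncomputable def superSign {k : ℕ} (σ : Equiv.Perm (Fin k)) (px : Fin k → ZMod 2) : ℂ :=
  (-1 : ℂ) ^ (Finset.univ.filter (fun ij : Fin k × Fin k =>
      ij.1 < ij.2 ∧ σ ij.2 < σ ij.1 ∧ px (σ ij.1) = 1 ∧ px (σ ij.2) = 1)).card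

/-- The ordered matrix product `X (σ 0) * X (σ 1) * ⋯ * X (σ (k-1))`. -/
noncomputable def permProd {k p q : ℕ} (σ : Equiv.Perm (Fin k))
    (X : Fin k → Matrix (Idx p q) (Idx p q) ℂ) : Matrix (Idx p q) (Idx p q) ℂ :=
  (List.ofFn fun i => X (σ i)).prod

/-- The standard supersymmetric super polynomial `𝒫_k`. -/
noncomputable def symPoly {k p q : ℕ} (X : Fin k → Matrix (Idx p q) (Idx p q) ℂ)
    (px : Fin k → ZMod 2) : Matrix (Idx p q) (Idx p q) ℂ :=
  ∑ σ : Equiv.Perm (Fin k), superSign σ px • permProd σ X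

/-- The standard skew supersymmetric super polynomial `𝒜_k`. -/
noncomputable def skewPoly {k p q : ℕ} (X : Fin k → Matrix (Idx p q) (Idx p q) ℂ)
    (px : Fin k → ZMod 2) : Matrix (Idx p q) (Idx p q) ℂ :=
  ∑ σ : Equiv.Perm (Fin k),
    (((Equiv.Perm.sign σ : ℤ) : ℂ) * superSign σ px) • permProd σ X

/-- The supertrace `str X = tr A - tr D` of a matrix in `gl(p,q)`. -/
noncomputable def strace {p q : ℕ} (X : Matrix (Idx p q) (Idx p q) ℂ) : ℂ :=
  ∑ i : Fin p, X (Sum.inl i) (Sum.inl i) - ∑ j : Fin q, X (Sum.inr j) (Sum.inr j)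

/-- The super bracket `[A,B] = AB - (-1)^{|A||B|} BA` of homogeneous matrices
`A`, `B` of parities `a`, `b`. -/
noncomputable def sbr {p q : ℕ} (A : Matrix (Idx p q) (Idx p q) ℂ) (a : ZMod 2)
    (B : Matrix (Idx p q) (Idx p q) ℂ) (b : ZMod 2) : Matrix (Idx p q) (Idx p q) ℂ :=
  A * B - sgn (a * b) • (B * A)

/-- The matrix of the even bilinear form `B` on `ℂ ⊕ ℂ^{2n}`: it is `1` on the
even line, `0` between the even and odd parts, and the standard symplectic form
with matrix `[[0, Iₙ],[-Iₙ, 0]]` on `ℂ^{2n}`. -/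
noncomputable def Bmat (n : ℕ) : Matrix (Idx 1 (2*n)) (Idx 1 (2*n)) ℂ :=
  fun i j => match i, j with
  | Sum.inl _, Sum.inl _ => 1
  | Sum.inl _, Sum.inr _ => 0
  | Sum.inr _, Sum.inl _ => 0
  | Sum.inr a, Sum.inr b =>
      if a.val + n = b.val then 1 else if b.val + n = a.val then -1 else 0

/-- The bilinear form `B(u,v)` on `ℂ ⊕ ℂ^{2n}`. -/
noncomputable def Bform (n : ℕ) (u v : Idx 1 (2*n) → ℂ) : ℂ :=
  ∑ i, ∑ j, u i * Bmat n i j * v j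

/-- `X` is a homogeneous element of `osp(1,2n)` of parity `ε`:
`B(Xu,v) + (-1)^{|X||u|} B(u,Xv) = 0` for all homogeneous `u`, `v`. -/
def ospMem {n : ℕ} (X : Matrix (Idx 1 (2*n)) (Idx 1 (2*n)) ℂ) (ε : ZMod 2) : Prop :=
  HasParity X ε ∧
  ∀ (u v : Idx 1 (2*n) → ℂ) (εu εv : ZMod 2), VHasParity u εu → VHasParity v εv →
    Bform n (X.mulVec u) v + sgn (ε * εu) * Bform n u (X.mulVec v) = 0

open Polynomial in
theorem derivative_det_eq_sum {m R : Type*} [Fintype m] [DecidableEq m] [CommRing R]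
    (M : Matrix m m R[X]) :
    derivative M.det = ∑ i, (M.updateCol i fun k => derivative (M k i)).det := by
  simp only [Matrix.det_apply, derivative_sum, derivative_smul]
  rw [Finset.sum_comm]
  refine Finset.sum_congr rfl fun σ _ => ?_
  rw [← Finset.smul_sum, derivative_prod_finset]
  congr 1
  refine Finset.sum_congr rfl fun i _ => ?_
  rw [← Finset.prod_erase_mul _ _ (Finset.mem_univ i)]
  congr 1
  · refine Finset.prod_congr rfl fun j hj => ?_
    rw [Matrix.updateCol_ne (Finset.ne_of_mem_erase hj)]
  · simp

open Polynomial in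
theorem derivative_charpoly_eq_trace_adjugate {m R : Type*} [Fintype m] [DecidableEq m]
    [CommRing R] (S : Matrix m m R) :
    derivative S.charpoly = (S.charmatrix.adjugate).trace := by
  rw [Matrix.charpoly, derivative_det_eq_sum, Matrix.trace]
  refine Finset.sum_congr rfl fun i _ => ?_
  rw [Matrix.diag_apply, ← Matrix.transpose_apply S.charmatrix.adjugate, Matrix.adjugate_transpose,
    Matrix.adjugate_apply, Matrix.updateRow_transpose, Matrix.det_transpose]
  congr 2
  ext k
  by_cases h : k = i
  · subst h; simp [Matrix.charmatrix_apply_eq]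
  · simp [h]

open Polynomial in
/-- Newton's identities for the characteristic polynomial. -/
theorem nat_mul_charpoly_coeff {m R : Type*} [Fintype m] [DecidableEq m]
    [CommRing R] (S : Matrix m m R) (i : ℕ) :
    (i : R) * S.charpoly.coeff i =
      ∑ j ∈ Finset.range (Fintype.card m + 1 - i), S.charpoly.coeff (i + j) * (S ^ j).trace := by
  have hlarge : ∀ k, Fintype.card m < k → S.charpoly.coeff k = 0 := fun k hk => by
    nontriviality R
    exact coeff_eq_zero_of_natDegree_lt (by rwa [S.charpoly_natDegree_eq_dim])
  rcases i with _ | n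
  · have h := congrArg Matrix.trace (Matrix.aeval_self_charpoly S)
    rw [aeval_eq_sum_range' (n := Fintype.card m + 1)
      (by nontriviality R; rw [S.charpoly_natDegree_eq_dim]; omega)] at h
    simpa [Matrix.trace_sum, Matrix.trace_smul] using h.symm
  set B := matPolyEquiv S.charmatrix.adjugate with hB
  have hmul : B * (X - C S) = S.charpoly.map (algebraMap R (Matrix m m R)) := by
    rw [hB, ← Matrix.matPolyEquiv_charmatrix, ← map_mul, Matrix.adjugate_mul,
      matPolyEquiv_smul_one]
    rfl
  have hstep : ∀ k, B.coeff k = B.coeff (k + 1) * S + S.charpoly.coeff (k + 1) • 1 := by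
    intro k
    have h := congrArg (fun p => p.coeff (k + 1)) hmul
    simp only [mul_sub, coeff_sub, coeff_mul_X, coeff_mul_C, coeff_map,
      Algebra.algebraMap_eq_smul_one] at h
    rw [← h]; abel
  have hsum : ∀ N, B.coeff n = B.coeff (n + N) * S ^ N +
      ∑ j ∈ Finset.range N, S.charpoly.coeff (n + 1 + j) • S ^ j := by
    intro N
    induction N with
    | zero => simp
    | succ N ih =>
      rw [ih, hstep (n + N), Finset.sum_range_succ, add_mul, mul_assoc, ← pow_succ', smul_mul_assoc,
        one_mul, show n + 1 + N = n + N + 1 by ring, ← add_assoc n N 1]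
      abel
  have htr : (B.coeff n).trace = ((n + 1 : ℕ) : R) * S.charpoly.coeff (n + 1) := by
    have h := congrArg (fun p => p.coeff n) (derivative_charpoly_eq_trace_adjugate S)
    simp only [coeff_derivative, Matrix.trace, finsetSum_coeff] at h
    simp only [hB, Matrix.trace, Matrix.diag_apply, matPolyEquiv_coeff_apply] at h ⊢
    rw [← h]; push_cast; ring
  have hN := hsum (Fintype.card m + 1 - (n + 1) + (B.natDegree + 1))
  rw [coeff_eq_zero_of_natDegree_lt
    (n := n + (Fintype.card m + 1 - (n + 1) + (B.natDegree + 1))) (by omega),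
    zero_mul, zero_add] at hN
  rw [← htr, hN, Matrix.trace_sum]
  simp only [Matrix.trace_smul, smul_eq_mul]
  symm
  apply Finset.sum_subset
  · intro j hj; simp only [Finset.mem_range] at *; omega
  · intro j _ hj
    rw [hlarge _ (by simp only [Finset.mem_range] at hj; omega), zero_mul]

/-- The polynomial functions `ℂ → E` with coefficients in a complex vector space `E`. -/
def polyFun (E : Type*) [AddCommGroup E] [Module ℂ E] : Submodule ℂ (ℂ → E) :=
  Submodule.span ℂ {f | ∃ (i : ℕ) (a : E), f = fun τ => τ ^ i • a}

theorem const_mem_polyFun {E : Type*} [AddCommGroup E] [Module ℂ E] (a : E) :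
    (fun _ => a) ∈ polyFun E :=
  Submodule.subset_span ⟨0, a, by simp⟩

theorem smul_const_mem_polyFun {E : Type*} [AddCommGroup E] [Module ℂ E] (a : E) :
    (fun τ : ℂ => τ • a) ∈ polyFun E :=
  Submodule.subset_span ⟨1, a, by simp⟩

theorem linearMap_comp_mem_polyFun {E F : Type*} [AddCommGroup E] [Module ℂ E] [AddCommGroup F]
    [Module ℂ F] (L : E →ₗ[ℂ] F) {f : ℂ → E} (hf : f ∈ polyFun E) :
    (fun τ => L (f τ)) ∈ polyFun F := by
  induction hf using Submodule.span_induction with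
  | mem f hf =>
    obtain ⟨i, a, rfl⟩ := hf
    exact Submodule.subset_span ⟨i, L a, by simp⟩
  | zero =>
    convert (polyFun F).zero_mem using 1
    ext τ
    simp
  | add f g _ _ hf hg =>
    convert (polyFun F).add_mem hf hg using 1
    ext τ
    simp
  | smul c f _ hf =>
    convert (polyFun F).smul_mem c hf using 1
    ext τ
    simp

theorem bilinear_mem_polyFun {E F H : Type*} [AddCommGroup E] [Module ℂ E] [AddCommGroup F]
    [Module ℂ F] [AddCommGroup H] [Module ℂ H] (B : E →ₗ[ℂ] F →ₗ[ℂ] H) {f : ℂ → E} {g : ℂ → F}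
    (hf : f ∈ polyFun E) (hg : g ∈ polyFun F) : (fun τ => B (f τ) (g τ)) ∈ polyFun H := by
  induction hf using Submodule.span_induction with
  | mem f hf =>
    obtain ⟨i, a, rfl⟩ := hf
    induction hg using Submodule.span_induction with
    | mem g hg =>
      obtain ⟨j, b, rfl⟩ := hg
      refine Submodule.subset_span ⟨i + j, B a b, ?_⟩
      ext τ
      rw [map_smul, map_smul, LinearMap.smul_apply, smul_smul, pow_add, mul_comm]
    | zero =>
      convert (polyFun H).zero_mem using 1
      ext τ
      simp
    | add f g _ _ hf hg =>
      convert (polyFun H).add_mem hf hg using 1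
      ext τ
      simp
    | smul c f _ hf =>
      convert (polyFun H).smul_mem c hf using 1
      ext τ
      rw [Pi.smul_apply, Pi.smul_apply, map_smul]
  | zero =>
    convert (polyFun H).zero_mem using 1
    ext τ
    simp
  | add f g _ _ hf hg =>
    convert (polyFun H).add_mem hf hg using 1
    ext τ
    simp
  | smul c f _ hf =>
    convert (polyFun H).smul_mem c hf using 1
    ext τ
    simp

theorem mul_mem_polyFun {E : Type*} [Ring E] [Algebra ℂ E] {f g : ℂ → E}
    (hf : f ∈ polyFun E) (hg : g ∈ polyFun E) : (fun τ => f τ * g τ) ∈ polyFun E :=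
  bilinear_mem_polyFun (LinearMap.mul ℂ E) hf hg

theorem pow_mem_polyFun {E : Type*} [Ring E] [Algebra ℂ E] {f : ℂ → E}
    (hf : f ∈ polyFun E) (k : ℕ) : (fun τ => f τ ^ k) ∈ polyFun E := by
  induction k with
  | zero => simpa using const_mem_polyFun (1 : E)
  | succ k ih => simpa only [pow_succ] using mul_mem_polyFun ih hf

theorem sum_mem_polyFun {ι E : Type*} [AddCommGroup E] [Module ℂ E] (s : Finset ι)
    {f : ι → ℂ → E} (hf : ∀ i ∈ s, f i ∈ polyFun E) :
    (fun τ => ∑ i ∈ s, f i τ) ∈ polyFun E := by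
  convert (polyFun E).sum_mem hf using 1
  ext τ
  simp

/-- A polynomial function that vanishes away from `0` vanishes at `0`. -/
theorem polyFun_zero_eq_zero {E : Type*} [AddCommGroup E] [Module ℂ E] {f : ℂ → E}
    (hf : f ∈ polyFun E) (h : ∀ τ, τ ≠ 0 → f τ = 0) : f 0 = 0 := by
  rw [← Module.forall_dual_apply_eq_zero_iff ℂ]
  intro φ
  have hp : ∃ p : Polynomial ℂ, ∀ τ, φ (f τ) = p.eval τ := by
    clear h
    induction hf using Submodule.span_induction with
    | mem f hf =>
      obtain ⟨i, a, rfl⟩ := hf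
      exact ⟨Polynomial.C (φ a) * Polynomial.X ^ i, fun τ => by
        rw [map_smul, smul_eq_mul, mul_comm]; simp⟩
    | zero => exact ⟨0, by simp⟩
    | add f g _ _ hf hg =>
      obtain ⟨p, hp⟩ := hf
      obtain ⟨q, hq⟩ := hg
      exact ⟨p + q, fun τ => by simp [hp, hq]⟩
    | smul c f _ hf =>
      obtain ⟨p, hp⟩ := hf
      exact ⟨Polynomial.C c * p, fun τ => by simp [hp]⟩
  obtain ⟨p, hp⟩ := hp
  have hzero : p = 0 := by
    refine Polynomial.eq_zero_of_infinite_isRoot p ?_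
    refine Set.Infinite.mono (s := {0}ᶜ) (fun τ hτ => ?_) (Set.finite_singleton 0).infinite_compl
    rw [Set.mem_ofPred_eq, Polynomial.IsRoot, ← hp, h τ hτ, map_zero]
  rw [hp, hzero, Polynomial.eval_zero]
theorem mul_pow_succ_eq {p m Λ : Type*} [Fintype p] [DecidableEq p] [Fintype m] [DecidableEq m]
    [Ring Λ] (P : Matrix p m Λ) (Q : Matrix m p Λ) (k : ℕ) :
    (P * Q) ^ (k + 1) = P * (Q * P) ^ k * Q := by
  induction k with
  | zero => simp
  | succ k ih => rw [pow_succ, ih, pow_succ (Q * P)]; simp only [Matrix.mul_assoc]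

/-- The supertrace of a matrix over `Λ` with one even row. -/
def blockStr {m Λ : Type*} [Fintype m] [Ring Λ] [Algebra ℂ Λ] :
    Matrix (Fin 1 ⊕ m) (Fin 1 ⊕ m) Λ →ₗ[ℂ] Λ where
  toFun X := X (Sum.inl 0) (Sum.inl 0) - ∑ i, X (Sum.inr i) (Sum.inr i)
  map_add' X Y := by simp only [Matrix.add_apply, Finset.sum_add_distrib]; abel
  map_smul' c X := by simp [smul_sub, Finset.smul_sum]

/-- The coefficients of a monic polynomial with prescribed power sums. -/
noncomputable def newtonCoeff {Λ : Type*} [Ring Λ] [Algebra ℂ Λ] (s : ℕ → Λ) : ℕ → Λ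
  | 0 => 1
  | k + 1 => -((k + 1 : ℂ)⁻¹) • ∑ j : Fin (k + 1), newtonCoeff s j * s (k + 1 - j)

theorem newtonCoeff_succ_eq_zero {Λ : Type*} [Ring Λ] [Algebra ℂ Λ] {s : ℕ → Λ}
    (hs : ∀ j, s (j + 1) = 0) (k : ℕ) : newtonCoeff s (k + 1) = 0 := by
  rw [newtonCoeff]
  convert smul_zero _
  refine Finset.sum_eq_zero fun j _ => ?_
  rw [show k + 1 - (j : ℕ) = (k - j) + 1 by omega, hs, mul_zero]

theorem newtonCoeff_mem_polyFun {Λ : Type*} [Ring Λ] [Algebra ℂ Λ] {s : ℂ → ℕ → Λ}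
    (hs : ∀ j, (fun τ => s τ j) ∈ polyFun Λ) (k : ℕ) :
    (fun τ => newtonCoeff (s τ) k) ∈ polyFun Λ := by
  induction k using Nat.strong_induction_on with
  | _ k ih =>
    rcases k with _ | k
    · simpa only [newtonCoeff] using const_mem_polyFun (1 : Λ)
    · simp only [newtonCoeff]
      exact (polyFun Λ).smul_mem _
        (sum_mem_polyFun _ fun j _ => mul_mem_polyFun (ih j j.2) (hs _))

theorem charpoly_coeff_eq_newtonCoeff {m R Λ : Type*} [Fintype m] [DecidableEq m] [CommRing R]
    [Ring Λ] [Algebra R Λ] [Algebra ℂ Λ] (W : Matrix m m R) (s : ℕ → Λ)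
    (hs : ∀ j, algebraMap R Λ (W ^ (j + 1)).trace = s (j + 1)) (k : ℕ)
    (hk : k ≤ Fintype.card m) :
    algebraMap R Λ (W.charpoly.coeff (Fintype.card m - k)) = newtonCoeff s k := by
  induction k using Nat.strong_induction_on with
  | _ k ih =>
    rcases k with _ | k
    · rcases subsingleton_or_nontrivial R with hR | hR
      · rw [newtonCoeff, Subsingleton.elim (W.charpoly.coeff _) 1, map_one]
      rw [newtonCoeff, Nat.sub_zero, ← W.charpoly_natDegree_eq_dim,
        W.charpoly_monic.coeff_natDegree, map_one]
    · have h := nat_mul_charpoly_coeff W (Fintype.card m - (k + 1))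
      rw [show Fintype.card m + 1 - (Fintype.card m - (k + 1)) = (k + 1) + 1 by omega,
        Finset.sum_range_succ', pow_zero, Matrix.trace_one, add_zero, Nat.cast_sub hk, sub_mul,
        mul_comm (W.charpoly.coeff _) (Fintype.card m : R), add_comm (∑ _ ∈ _, _), sub_eq_add_neg,
        add_right_inj, ← Finset.sum_range_reflect] at h
      have h' := congrArg (algebraMap R Λ) h
      rw [newtonCoeff, Fin.sum_univ_eq_sum_range (fun j => newtonCoeff s j * s (k + 1 - j))]
      rw [map_neg, map_mul, map_natCast, map_sum] at h'
      have h2 : ∑ j ∈ Finset.range (k + 1), newtonCoeff s j * s (k + 1 - j) =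
          - (((k + 1 : ℕ) : ℂ) • algebraMap R Λ (W.charpoly.coeff (Fintype.card m - (k + 1)))) := by
        rw [Nat.cast_smul_eq_nsmul, nsmul_eq_mul, h']
        refine Finset.sum_congr rfl fun j hj => ?_
        rw [Finset.mem_range] at hj
        rw [map_mul, hs, ← ih j hj (by omega)]
        congr 3 <;> omega
      rw [h2, smul_neg, neg_smul, neg_neg, smul_smul, Nat.cast_add_one,
        inv_mul_cancel₀ (Nat.cast_add_one_ne_zero k), one_smul]

/-- A Cayley–Hamilton identity for an even matrix `[[0, b], [S x, S]]` with `b x = 0`. -/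
theorem sum_newtonCoeff_smul_pow_eq_zero {m R Λ : Type*} [Fintype m] [DecidableEq m] [CommRing R]
    [Ring Λ] [Algebra R Λ] [Algebra ℂ Λ] (S W : Matrix m m R)
    (b : Matrix (Fin 1) m Λ) (x : Matrix m (Fin 1) Λ) (hbx : b * x = 0)
    (hW : W.map (algebraMap R Λ) = x * b + S.map (algebraMap R Λ))
    (hxb : ∀ i j, x i 0 * b 0 j = -(b 0 j * x i 0)) :
    let M := Matrix.fromBlocks 0 b (S.map (algebraMap R Λ) * x) (S.map (algebraMap R Λ))
    ∑ k ∈ Finset.range (Fintype.card m + 1),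
      newtonCoeff (fun j => -blockStr (M ^ j)) k • M ^ (Fintype.card m - k + 1) = 0 := by
  intro M
  set ψ := (Algebra.ofId R Λ).mapMatrix (m := m) with hψ
  have hψa : ∀ Z : Matrix m m R, ψ Z = Z.map (algebraMap R Λ) := fun Z => rfl
  set P := Matrix.fromRows b (ψ S)
  set Q := Matrix.fromCols x (1 : Matrix m m Λ)
  have hPQ : M = P * Q := by
    rw [Matrix.fromRows_mul_fromCols, hbx, Matrix.mul_one, Matrix.mul_one]
    rfl
  have hQP : Q * P = ψ W := by
    rw [Matrix.fromCols_mul_fromRows, Matrix.one_mul, hψa, hψa, hW]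
  have hpow : ∀ k, M ^ (k + 1) = P * ψ (W ^ k) * Q := fun k => by
    rw [hPQ, mul_pow_succ_eq, hQP, map_pow]
  have hstr : ∀ k, algebraMap R Λ (W ^ (k + 1)).trace = -blockStr (M ^ (k + 1)) := by
    intro k
    have h1 : algebraMap R Λ (W ^ (k + 1)).trace = (ψ (W ^ (k + 1))).trace := by
      simp [hψa, Matrix.trace]
    have h2 : blockStr (M ^ (k + 1)) =
        (b * ψ (W ^ k) * x) 0 0 - (ψ S * ψ (W ^ k)).trace := by
      rw [hpow, Matrix.fromRows_mul, Matrix.fromRows_mul_fromCols, Matrix.mul_one, Matrix.mul_one]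
      rfl
    have h3 : (x * b * ψ (W ^ k)).trace = -(b * ψ (W ^ k) * x) 0 0 := by
      rw [Matrix.mul_assoc, Matrix.trace, Matrix.mul_apply, ← Finset.sum_neg_distrib]
      refine Finset.sum_congr rfl fun i _ => ?_
      simp only [Matrix.diag_apply, Matrix.mul_apply, Finset.univ_unique, Finset.sum_singleton,
        Finset.mul_sum, Finset.sum_mul, ← Finset.sum_neg_distrib, Fin.default_eq_zero]
      refine Finset.sum_congr rfl fun j _ => ?_
      rw [← mul_assoc, hxb, hψa, Matrix.map_apply, neg_mul, mul_assoc, mul_assoc,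
        Algebra.commutes]
    rw [h1, h2, pow_succ', map_mul, hψa W, hW, add_mul, Matrix.trace_add, h3]
    simp only [hψa]
    abel
  have hCH : ∑ i ∈ Finset.range (Fintype.card m + 1), W.charpoly.coeff i • M ^ (i + 1) = 0 := by
    have h := Matrix.aeval_self_charpoly W
    rw [Polynomial.aeval_eq_sum_range' (n := Fintype.card m + 1)
      (by nontriviality R; rw [W.charpoly_natDegree_eq_dim]; omega)] at h
    have h2 := congrArg (fun Z => P * ψ Z * Q) h
    simp only [map_sum, map_smul, map_zero, Matrix.mul_zero, Matrix.zero_mul, Matrix.mul_sum,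
      Matrix.sum_mul, Matrix.mul_smul, Matrix.smul_mul] at h2
    simpa only [hpow] using h2
  rw [← hCH, ← Finset.sum_range_reflect]
  refine Finset.sum_congr rfl fun k hk => ?_
  rw [Finset.mem_range] at hk
  rw [← charpoly_coeff_eq_newtonCoeff W _ hstr _ (by omega)]
  rw [show Fintype.card m - (Fintype.card m + 1 - 1 - k) = k by omega]
  ext i j
  simp [Algebra.smul_def]

/-- The commutation factor of the `ℤ₂ × ℤ₂`-graded sign rule. -/
noncomputable def colorSign (a b : ZMod 2 × ZMod 2) : ℂ := sgn (a.1 * b.1 + a.2 * b.2)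

/-- A `ℤ₂ × ℤ₂`-graded family of submodules of `Λ` whose elements commute up to `colorSign`, with
the degree `0` part contained in the commutative ring of scalars `R`. -/
structure ColorGrading {R Λ : Type*} [CommRing R] [Ring Λ] [Algebra R Λ] [Algebra ℂ Λ]
    (G : ZMod 2 × ZMod 2 → Submodule R Λ) : Prop where
  mul_mem : ∀ {a b x y}, x ∈ G a → y ∈ G b → x * y ∈ G (a + b)
  comm : ∀ {a b x y}, x ∈ G a → y ∈ G b → x * y = colorSign a b • (y * x)
  one_mem : 1 ∈ G 0
  exists_algebraMap : ∀ {x}, x ∈ G 0 → ∃ r, algebraMap R Λ r = x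
  injective : Function.Injective (algebraMap R Λ)

theorem eq_zero_of_eq_neg_self {E : Type*} [AddCommGroup E] [Module ℂ E] {x : E} (h : x = -x) :
    x = 0 := by
  have h2 : (2 : ℂ) • x = 0 := by
    rw [two_smul]
    nth_rewrite 1 [h]
    exact neg_add_cancel x
  simpa using h2

theorem sum_sum_smul_mul_eq_zero {m R Λ : Type*} [Fintype m] [CommRing R]
    [Ring Λ] [Algebra R Λ] [Algebra ℂ Λ] {x : m → Λ} (hx : ∀ i j, x i * x j = -(x j * x i))
    {K : Matrix m m R} (hK : ∀ i j, K i j = K j i) : ∑ i, ∑ j, K i j • (x i * x j) = 0 := by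
  have h : ∑ i, ∑ j, K i j • (x i * x j) = -∑ i, ∑ j, K i j • (x i * x j) := by
    conv_rhs => rw [Finset.sum_comm]
    rw [← Finset.sum_neg_distrib]
    refine Finset.sum_congr rfl fun i _ => ?_
    rw [← Finset.sum_neg_distrib]
    refine Finset.sum_congr rfl fun j _ => ?_
    rw [hx i j, hK i j, smul_neg]
  exact eq_zero_of_eq_neg_self h

/-- The parity of a row of a matrix with one even row. -/
def blockParity {m : Type*} : Fin 1 ⊕ m → ZMod 2
  | Sum.inl _ => 0
  | Sum.inr _ => 1

theorem ColorGrading.blockStr_mul_eq_neg {m R Λ : Type*} [Fintype m] [CommRing R] [Ring Λ]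
    [Algebra R Λ] [Algebra ℂ Λ] {G : ZMod 2 × ZMod 2 → Submodule R Λ} (hG : ColorGrading G)
    {X Y : Matrix (Fin 1 ⊕ m) (Fin 1 ⊕ m) Λ}
    (hX : ∀ i j, X i j ∈ G (1, blockParity i + blockParity j))
    (hY : ∀ i j, Y i j ∈ G (1, blockParity i + blockParity j)) :
    blockStr (X * Y) = -blockStr (Y * X) := by
  have key : ∀ Z V : Matrix (Fin 1 ⊕ m) (Fin 1 ⊕ m) Λ,
      blockStr (Z * V) = ∑ i, ∑ j, sgn (blockParity i) • (Z i j * V j i) := by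
    intro Z V
    simp only [blockStr, LinearMap.coe_mk, AddHom.coe_mk, Matrix.mul_apply,
      ← Finset.smul_sum, blockParity]
    simp only [Finset.univ_unique, Finset.sum_singleton, Fintype.sum_sum_type, sgn,
      Finset.sum_add_distrib]
    simp [Finset.sum_add_distrib]
    abel
  rw [key, key, Finset.sum_comm, ← Finset.sum_neg_distrib]
  refine Finset.sum_congr rfl fun i _ => ?_
  rw [← Finset.sum_neg_distrib]
  refine Finset.sum_congr rfl fun j _ => ?_
  rw [hG.comm (hX j i) (hY i j), smul_smul, ← neg_smul]
  congr 1
  rcases i with i | i <;> rcases j with j | j <;>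
    simp [colorSign, sgn, blockParity, CharTwo.add_self_eq_zero]

section osp

variable {m R Λ : Type*} [Fintype m] [DecidableEq m] [CommRing R] [Ring Λ] [Algebra R Λ]
  [Algebra ℂ Λ] {G : ZMod 2 × ZMod 2 → Submodule R Λ}

theorem ColorGrading.pow_apply_mem (hG : ColorGrading G) {A : Matrix (Fin 1 ⊕ m) (Fin 1 ⊕ m) Λ}
    (hA : ∀ i j, A i j ∈ G (1, blockParity i + blockParity j)) (k : ℕ) (i j) :
    (A ^ k) i j ∈ G ((k : ZMod 2), blockParity i + blockParity j) := by
  induction k generalizing i j with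
  | zero =>
    by_cases h : i = j
    · subst h
      simpa [CharTwo.add_self_eq_zero, ← Prod.zero_eq_mk] using hG.one_mem
    · simp [Matrix.one_apply_ne h]
  | succ k ih =>
    rw [pow_succ, Matrix.mul_apply]
    refine Submodule.sum_mem _ fun l _ => ?_
    convert hG.mul_mem (ih i l) (hA l j) using 2
    rw [Prod.mk_add_mk, Nat.cast_succ, add_assoc (blockParity i), ← add_assoc (blockParity l),
      CharTwo.add_self_eq_zero, zero_add]

theorem ColorGrading.blockStr_even_pow_eq_zero (hG : ColorGrading G)
    {A : Matrix (Fin 1 ⊕ m) (Fin 1 ⊕ m) Λ}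
    (hA : ∀ i j, A i j ∈ G (1, blockParity i + blockParity j)) (k : ℕ) :
    blockStr ((A * A) ^ (k + 1)) = 0 := by
  have hk : ∀ i j, (A ^ (2 * k + 1)) i j ∈ G (1, blockParity i + blockParity j) := by
    intro i j
    convert hG.pow_apply_mem hA (2 * k + 1) i j
    push_cast
    rw [show (2 : ZMod 2) = 0 from rfl]
    ring
  have h := hG.blockStr_mul_eq_neg hA hk
  rw [← pow_succ', ← pow_succ] at h
  rw [← sq, ← pow_mul]
  exact eq_zero_of_eq_neg_self h

theorem isUnit_det_add_of_isNilpotent {S T : Matrix m m R} (hS : ∀ i j, IsNilpotent (S i j))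
    (hT : IsUnit T.det) : IsUnit (S + T).det := by
  let q := Ideal.Quotient.mk (nilradical R)
  have h : q (S + T).det = q T.det := by
    rw [RingHom.map_det, RingHom.map_det]
    congr 1
    ext i j
    simp only [RingHom.mapMatrix_apply, Matrix.map_apply, Matrix.add_apply, map_add, q,
      Ideal.Quotient.eq_zero_iff_mem.mpr (mem_nilradical.mpr (hS i j)), zero_add]
  have hn : IsNilpotent ((S + T).det - T.det) := by
    rw [← mem_nilradical, ← Ideal.Quotient.eq_zero_iff_mem, map_sub, sub_eq_zero]
    exact h
  have := hn.isUnit_add_left_of_commute hT (Commute.all _ _)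
  simpa using this

end osp

section osp

variable {m R Λ : Type*} [Fintype m] [DecidableEq m] [CommRing R] [Ring Λ] [Algebra R Λ]
  [Algebra ℂ Λ] {G : ZMod 2 × ZMod 2 → Submodule R Λ}

/-- The `Λ`-valued matrix with rows `(0, b)` and `(c, D)`. -/
def bordered (b c : m → Λ) (D : Matrix m m Λ) : Matrix (Fin 1 ⊕ m) (Fin 1 ⊕ m) Λ :=
  Matrix.fromBlocks 0 (Matrix.replicateRow (Fin 1) b) (Matrix.replicateCol (Fin 1) c) D

theorem ColorGrading.sum_newtonCoeff_bordered_eq_zero (hG : ColorGrading G) {J S : Matrix m m R}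
    (hS : IsUnit S.det) (hJS : (Jᵀ * S).IsSymm) {β γ : m → Λ} (hγ : ∀ i, γ i ∈ G (0, 1))
    (hβ : ∀ j, β j = -∑ k, J k j • γ k) :
    ∑ k ∈ Finset.range (Fintype.card m + 1),
      newtonCoeff (fun j => -blockStr (bordered β γ (S.map (algebraMap R Λ)) ^ j)) k •
        bordered β γ (S.map (algebraMap R Λ)) ^ (Fintype.card m - k + 1) = 0 := by
  have hβG : ∀ j, β j ∈ G (0, 1) := fun j => by
    rw [hβ]
    exact neg_mem (Submodule.sum_mem _ fun k _ => Submodule.smul_mem _ _ (hγ k))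
  set ψ := (algebraMap R Λ)
  let x : Matrix m (Fin 1) Λ := (S⁻¹).map ψ * Matrix.replicateCol (Fin 1) γ
  have hSx : S.map ψ * x = Matrix.replicateCol (Fin 1) γ := by
    rw [← Matrix.mul_assoc, ← Matrix.map_mul, Matrix.mul_nonsing_inv _ hS,
      Matrix.map_one _ (map_zero _) (map_one _), Matrix.one_mul]
  have hx : ∀ i, x i 0 ∈ G (0, 1) := fun i => by
    refine Submodule.sum_mem _ fun k _ => ?_
    have := Submodule.smul_mem _ (S⁻¹ i k) (hγ k)
    rwa [Algebra.smul_def] at this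
  have hanti : ∀ {y z}, y ∈ G (0, 1) → z ∈ G (0, 1) → y * z = -(z * y) := fun hy hz => by
    simpa [colorSign, sgn] using hG.comm hy hz
  have hγx : ∀ k, γ k = ∑ l, S k l • x l 0 := fun k => by
    have := congrFun (congrFun hSx k) 0
    rw [Matrix.replicateCol_apply] at this
    rw [← this, Matrix.mul_apply]
    simp only [Matrix.map_apply, Algebra.smul_def]
    rfl
  have hβx : Matrix.replicateRow (Fin 1) β * x = 0 := by
    ext i j
    obtain rfl := Subsingleton.elim 0 j
    rw [Matrix.mul_apply, Matrix.zero_apply]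
    have h0 := sum_sum_smul_mul_eq_zero (x := fun l => x l 0) (K := Jᵀ * S)
      (fun i j => hanti (hx i) (hx j)) (fun i j => hJS.apply j i)
    have h1 : ∀ j, Matrix.replicateRow (Fin 1) β i j * x j 0 =
        -∑ l, (Jᵀ * S) j l • (x l 0 * x j 0) := fun j => by
      rw [Matrix.replicateRow_apply, hβ, neg_mul]
      simp only [hγx, Matrix.mul_apply, Matrix.transpose_apply, Finset.sum_mul, Finset.smul_sum,
        Finset.sum_smul, smul_smul, smul_mul_assoc]
      rw [Finset.sum_comm]
    simp only [h1, Finset.sum_neg_distrib]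
    rw [Finset.sum_comm, neg_eq_zero, ← h0]
    refine Finset.sum_congr rfl fun i _ => Finset.sum_congr rfl fun j _ => ?_
    rw [hJS.apply]
  have hxβ : ∀ i j, ∃ r, ψ r = x i 0 * β j := fun i j =>
    hG.exists_algebraMap (by
      convert hG.mul_mem (hx i) (hβG j) using 2
      decide)
  choose w hw using hxβ
  have := sum_newtonCoeff_smul_pow_eq_zero S (Matrix.of w + S) (Matrix.replicateRow (Fin 1) β) x
    hβx (by
      ext i j
      simp [Matrix.mul_apply, hw, ψ])
    (fun i j => hanti (hx i) (hβG j))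
  rw [hSx] at this
  exact this

theorem ColorGrading.bordered_pow_eq_zero [Algebra ℂ R] [IsScalarTower ℂ R Λ]
    (hG : ColorGrading G) {J : Matrix m m ℂ} (hJ : IsUnit J.det) {S : Matrix m m R}
    (hS : ∀ i j, IsNilpotent (S i j)) (hJS : ((J.map (algebraMap ℂ R))ᵀ * S).IsSymm)
    {β γ : m → Λ} (hγ : ∀ i, γ i ∈ G (0, 1)) (hβ : ∀ j, β j = -∑ k, J k j • γ k)
    (hstr : ∀ k, blockStr (bordered β γ (S.map (algebraMap R Λ)) ^ (k + 1)) = 0) :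
    bordered β γ (S.map (algebraMap R Λ)) ^ (Fintype.card m + 1) = 0 := by
  let M : ℂ → Matrix (Fin 1 ⊕ m) (Fin 1 ⊕ m) Λ := fun τ =>
    bordered β γ (S.map (algebraMap R Λ)) + τ • bordered 0 0 (J.map (algebraMap ℂ Λ))
  have hM : M ∈ polyFun _ :=
    add_mem (const_mem_polyFun _) (smul_const_mem_polyFun _)
  let F : ℂ → Matrix (Fin 1 ⊕ m) (Fin 1 ⊕ m) Λ := fun τ =>
    ∑ k ∈ Finset.range (Fintype.card m + 1),
      newtonCoeff (fun j => -blockStr (M τ ^ j)) k • M τ ^ (Fintype.card m - k + 1)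
  have hF : F ∈ polyFun _ := by
    refine sum_mem_polyFun _ fun k _ => bilinear_mem_polyFun
      (Algebra.lsmul ℂ ℂ (Matrix (Fin 1 ⊕ m) (Fin 1 ⊕ m) Λ)).toLinearMap
      (newtonCoeff_mem_polyFun (fun j => ?_) k) (pow_mem_polyFun hM _)
    exact linearMap_comp_mem_polyFun (-blockStr) (pow_mem_polyFun hM j)
  have hF0 : F 0 = 0 := by
    refine polyFun_zero_eq_zero hF fun τ hτ => ?_
    have hMτ : M τ =
        bordered β γ ((S + τ • J.map (algebraMap ℂ R)).map (algebraMap R Λ)) := by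
      ext i j
      rcases i with i | i <;> rcases j with j | j <;>
        simp [M, bordered, ← IsScalarTower.algebraMap_apply ℂ R Λ,
          Algebra.smul_def τ (_ : R), Algebra.smul_def τ (_ : Λ)]
    have hdet : IsUnit (S + τ • J.map (algebraMap ℂ R)).det := by
      refine isUnit_det_add_of_isNilpotent hS ?_
      have : τ • J.map (algebraMap ℂ R) = (algebraMap ℂ R).mapMatrix (τ • J) := by
        ext i j
        simp [Algebra.smul_def τ (_ : R)]
      rw [this, ← RingHom.map_det, Matrix.det_smul]
      exact ((hτ.isUnit.pow _).mul hJ).map _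
    have hsymm : ((J.map (algebraMap ℂ R))ᵀ * (S + τ • J.map (algebraMap ℂ R))).IsSymm := by
      rw [Matrix.mul_add, Matrix.mul_smul]
      exact hJS.add ((Matrix.isSymm_transpose_mul_self _).smul τ)
    simp only [F, hMτ]
    exact hG.sum_newtonCoeff_bordered_eq_zero hdet hsymm hγ fun j => by
      simp [hβ, algebraMap_smul]
  have hM0 : M 0 = bordered β γ (S.map (algebraMap R Λ)) := by simp [M]
  simp only [F, hM0] at hF0
  rw [Finset.sum_range_succ', Finset.sum_eq_zero, zero_add] at hF0
  · simpa [newtonCoeff] using hF0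
  · intro k _
    rw [newtonCoeff_succ_eq_zero (fun j => by rw [hstr, neg_zero]), zero_smul]

theorem ColorGrading.osp_pow_eq_zero [Algebra ℂ R] [IsScalarTower ℂ R Λ] (hG : ColorGrading G)
    {J : Matrix m m ℂ} (hJ : IsUnit J.det) (hJt : ∀ i j, J j i = -J i j) {b c : m → Λ}
    {D : Matrix m m Λ} (hc : ∀ i, c i ∈ G (1, 1)) (hD : ∀ i j, D i j ∈ G (1, 0))
    (hb : ∀ j, b j = -∑ i, J i j • c i)
    (hDJ : ∀ i j, ∑ k, J k j • D k i + ∑ k, J i k • D k j = 0)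
    (hnil : ∀ i j, IsNilpotent (c i * b j + ∑ k, D i k * D k j)) :
    bordered b c D ^ (2 * (Fintype.card m + 1)) = 0 := by
  have hbG : ∀ j, b j ∈ G (1, 1) := fun j => by
    rw [hb]
    exact neg_mem (Submodule.sum_mem _ fun k _ => Submodule.smul_of_tower_mem _ _ (hc k))
  have hcomm : ∀ {y z}, y ∈ G (1, 1) → z ∈ G (1, 1) → y * z = z * y := fun hy hz => by
    simpa [colorSign, sgn, CharTwo.add_self_eq_zero] using hG.comm hy hz
  have hcD : ∀ i k l, c i * D k l = -(D k l * c i) := fun i k l => by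
    simpa [colorSign, sgn] using hG.comm (hc i) (hD k l)
  have hDD : ∀ i j k l, D i j * D k l = -(D k l * D i j) := fun i j k l => by
    simpa [colorSign, sgn] using hG.comm (hD i j) (hD k l)
  have hA : ∀ i j, bordered b c D i j ∈ G (1, blockParity i + blockParity j) := by
    rintro (i | i) (j | j)
    · exact zero_mem _
    · simpa [blockParity, bordered] using hbG j
    · simpa [blockParity, bordered] using hc i
    · simpa [blockParity, bordered, CharTwo.add_self_eq_zero] using hD i j
  have hbc : ∑ k, b k * c k = 0 := by
    have h : ∑ k, b k * c k = -∑ k, b k * c k := by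
      simp only [hb, neg_mul, Finset.sum_neg_distrib, neg_neg, Finset.sum_mul, smul_mul_assoc]
      conv_rhs => rw [Finset.sum_comm]
      rw [← Finset.sum_neg_distrib]
      refine Finset.sum_congr rfl fun i _ => ?_
      rw [← Finset.sum_neg_distrib]
      refine Finset.sum_congr rfl fun j _ => ?_
      rw [hJt, neg_smul, hcomm (hc i) (hc j), neg_neg]
    exact eq_zero_of_eq_neg_self h
  have hSG : ∀ i j, ∃ r, algebraMap R Λ r = c i * b j + ∑ k, D i k * D k j := fun i j => by
    refine hG.exists_algebraMap (add_mem ?_ (Submodule.sum_mem _ fun k _ => ?_))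
    · convert hG.mul_mem (hc i) (hbG j) using 2
      decide
    · convert hG.mul_mem (hD i k) (hD k j) using 2
      decide
  choose s hs using hSG
  set β : m → Λ := fun j => ∑ k, b k * D k j
  set γ : m → Λ := fun i => ∑ k, D i k * c k
  have hsq : bordered b c D * bordered b c D =
      bordered β γ ((Matrix.of s).map (algebraMap R Λ)) := by
    ext i j
    rcases i with i | i <;> rcases j with j | j <;>
      simp [bordered, Matrix.mul_apply, hs, hbc, β, γ]
  have hγ : ∀ i, γ i ∈ G (0, 1) := fun i => Submodule.sum_mem _ fun k _ => by
    convert hG.mul_mem (hD i k) (hc k) using 2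
    decide
  have hβ : ∀ j, β j = -∑ k, J k j • γ k := fun j => by
    have h1 : ∀ i, ∑ k, J i k • D k j = -∑ k, J k j • D k i := fun i =>
      eq_neg_of_add_eq_zero_right (hDJ i j)
    have h2 : β j = -∑ i, c i * ∑ k, J i k • D k j := by
      simp only [β, hb, neg_mul, Finset.sum_mul, Finset.mul_sum, Finset.sum_neg_distrib,
        smul_mul_assoc, mul_smul_comm]
      rw [Finset.sum_comm]
    rw [h2]
    simp only [h1, γ, Finset.mul_sum, mul_neg, Finset.sum_neg_distrib, mul_smul_comm, hcD,
      smul_neg, neg_neg, Finset.smul_sum]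
    rw [Finset.sum_comm]
  have hJS : ((J.map (algebraMap ℂ R))ᵀ * Matrix.of s).IsSymm := by
    have h1 : ∀ l j, ∑ i, J i j • D i l = -∑ i, J l i • D i j := fun l j =>
      eq_neg_of_add_eq_zero_left (hDJ l j)
    have h2 : ∀ j k, algebraMap R Λ (((J.map (algebraMap ℂ R))ᵀ * Matrix.of s) j k) =
        -(b j * b k) - ∑ l, ∑ i, J l i • (D i j * D l k) := fun j k => by
      simp only [Matrix.mul_apply, Matrix.transpose_apply, Matrix.map_apply, Matrix.of_apply,
        map_sum, map_mul, hs, ← IsScalarTower.algebraMap_apply ℂ R Λ]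
      simp only [← Algebra.smul_def, smul_add, Finset.sum_add_distrib, sub_eq_add_neg]
      congr 1
      · rw [hb j, neg_mul, neg_neg, Finset.sum_mul]
        simp only [smul_mul_assoc]
      · simp only [Finset.smul_sum]
        rw [Finset.sum_comm, ← Finset.sum_neg_distrib]
        refine Finset.sum_congr rfl fun l _ => ?_
        simp only [← smul_mul_assoc, ← Finset.sum_mul]
        rw [h1, neg_mul]
    ext j k
    apply hG.injective
    rw [Matrix.transpose_apply, h2, h2, hcomm (hbG k) (hbG j)]
    congr 1
    rw [Finset.sum_comm]
    refine Finset.sum_congr rfl fun l _ => Finset.sum_congr rfl fun i _ => ?_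
    rw [hJt, neg_smul, hDD, smul_neg, neg_neg]
  rw [pow_mul, sq, hsq]
  refine hG.bordered_pow_eq_zero hJ (fun i j => ?_) hJS hγ hβ fun k => ?_
  · obtain ⟨N, hN⟩ := hnil i j
    exact ⟨N, hG.injective (by rw [map_pow, Matrix.of_apply, hs, hN, map_zero])⟩
  · rw [← hsq]
    exact hG.blockStr_even_pow_eq_zero hA k

end osp

section colorCommuting

variable {Λ : Type*} [Ring Λ] [Algebra ℂ Λ]

theorem mul_list_prod_eq_zero {ι : Type*} {ε : ι → ι → ℂ} {ξ : ι → Λ}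
    (hcomm : ∀ i j, ξ i * ξ j = ε i j • (ξ j * ξ i)) (hsq : ∀ i, ξ i * ξ i = 0) {a : ι}
    {l : List ι} (ha : a ∈ l) : ξ a * (l.map ξ).prod = 0 := by
  induction l with
  | nil => simp at ha
  | cons b l ih =>
    rw [List.map_cons, List.prod_cons, ← mul_assoc]
    rcases List.mem_cons.mp ha with rfl | h
    · rw [hsq, zero_mul]
    · rw [hcomm, smul_mul_assoc, mul_assoc, ih h, mul_zero, smul_zero]

theorem list_prod_eq_zero_of_not_nodup {ι : Type*} {ε : ι → ι → ℂ} {ξ : ι → Λ}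
    (hcomm : ∀ i j, ξ i * ξ j = ε i j • (ξ j * ξ i)) (hsq : ∀ i, ξ i * ξ i = 0)
    {l : List ι} (hl : ¬l.Nodup) : (l.map ξ).prod = 0 := by
  induction l with
  | nil => simp at hl
  | cons a l ih =>
    rw [List.map_cons, List.prod_cons]
    by_cases ha : a ∈ l
    · exact mul_list_prod_eq_zero hcomm hsq ha
    · rw [ih fun h => hl (List.nodup_cons.mpr ⟨ha, h⟩), mul_zero]

variable {ι : Type*} [LinearOrder ι]

/-- The product of the commutation factors over all inversions of a list. -/
noncomputable def inversionSign (ε : ι → ι → ℂ) : List ι → ℂ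
  | [] => 1
  | a :: l => (l.map fun b => if b < a then ε a b else 1).prod * inversionSign ε l

theorem mul_list_prod_eq_orderedInsert {ε : ι → ι → ℂ} {ξ : ι → Λ}
    (hcomm : ∀ i j, ξ i * ξ j = ε i j • (ξ j * ξ i)) (a : ι) {l : List ι}
    (hl : l.Pairwise (· ≤ ·)) :
    ξ a * (l.map ξ).prod = (l.map fun b => if b < a then ε a b else 1).prod •
      ((l.orderedInsert (· ≤ ·) a).map ξ).prod := by
  induction l with
  | nil => simp
  | cons b l ih =>
    by_cases h : a ≤ b
    · have h1 : ((b :: l).map fun b => if b < a then ε a b else 1).prod = 1 := by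
        refine List.prod_eq_one fun x hx => ?_
        obtain ⟨c, hc, rfl⟩ := List.mem_map.mp hx
        rw [if_neg]
        rcases List.mem_cons.mp hc with rfl | hc
        · exact not_lt.mpr h
        · exact not_lt.mpr (h.trans ((List.pairwise_cons.mp hl).1 c hc))
      rw [h1, one_smul, List.orderedInsert_cons, if_pos h, List.map_cons (a := a), List.prod_cons]
    · rw [List.orderedInsert_cons, if_neg h, List.map_cons, List.prod_cons, ← mul_assoc, hcomm,
        smul_mul_assoc, mul_assoc, ih (List.pairwise_cons.mp hl).2, List.map_cons, List.prod_cons,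
        if_pos (not_le.mp h), List.map_cons, List.prod_cons, mul_smul_comm, smul_smul]

theorem list_prod_eq_insertionSort {ε : ι → ι → ℂ} {ξ : ι → Λ}
    (hcomm : ∀ i j, ξ i * ξ j = ε i j • (ξ j * ξ i)) (l : List ι) :
    (l.map ξ).prod = inversionSign ε l • ((l.insertionSort (· ≤ ·)).map ξ).prod := by
  induction l with
  | nil => simp [inversionSign]
  | cons a l ih =>
    rw [List.map_cons, List.prod_cons, ih, mul_smul_comm,
      mul_list_prod_eq_orderedInsert hcomm a (List.pairwise_insertionSort _ l), smul_smul,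
      List.insertionSort_cons, inversionSign, mul_comm (inversionSign ε l),
      ((List.perm_insertionSort (· ≤ ·) l).map _).prod_eq]

theorem inversionSign_ofFn (ε : ι → ι → ℂ) {n : ℕ} (f : Fin n → ι) :
    inversionSign ε (List.ofFn f) =
      ∏ i, ∏ j, if i < j ∧ f j < f i then ε (f i) (f j) else 1 := by
  induction n with
  | zero => simp [inversionSign]
  | succ n ih =>
    rw [List.ofFn_succ, inversionSign, ih, Fin.prod_univ_succ]
    congr 1
    · rw [Fin.prod_univ_succ, List.map_ofFn, List.prod_ofFn]
      simp
    · refine Finset.prod_congr rfl fun i _ => ?_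
      rw [Fin.prod_univ_succ]
      simp

end colorCommuting

theorem sgn_add (a b : ZMod 2) : sgn (a + b) = sgn a * sgn b := by
  have h : ∀ c : ZMod 2, c = 0 ∨ c = 1 := by decide
  rcases h a with rfl | rfl <;> rcases h b with rfl | rfl <;>
    simp [sgn, CharTwo.add_self_eq_zero]

theorem sgn_mul_self (a : ZMod 2) : sgn a * sgn a = 1 := by
  rw [← sgn_add, CharTwo.add_self_eq_zero]
  simp [sgn]

theorem prod_inversions_eq_sign_mul_superSign {k : ℕ} (σ : Equiv.Perm (Fin k))
    (px : Fin k → ZMod 2) :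
    (∏ i, ∏ j, if i < j ∧ σ j < σ i then sgn (1 + px (σ i) * px (σ j)) else 1) =
      ((Equiv.Perm.sign σ : ℤ) : ℂ) * superSign σ px := by
  have h1 : ((Equiv.Perm.sign σ : ℤ) : ℂ) =
      ∏ i, ∏ j, if i < j ∧ σ j < σ i then (-1 : ℂ) else 1 := by
    rw [Equiv.Perm.sign_eq_prod_prod_Ioi]
    push_cast
    refine Finset.prod_congr rfl fun i _ => ?_
    rw [← Finset.filter_lt_eq_Ioi, Finset.prod_filter]
    refine Finset.prod_congr rfl fun j _ => ?_
    rcases lt_or_ge i j with hij | hij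
    · rcases lt_or_gt_of_ne (σ.injective.ne hij.ne) with h | h
      · simp [hij, h, h.not_gt]
      · simp [hij, h, h.not_gt]
    · simp [hij.not_gt]
  have h2 : superSign σ px = ∏ i, ∏ j,
      if i < j ∧ σ j < σ i then sgn (px (σ i) * px (σ j)) else 1 := by
    rw [superSign, ← Finset.prod_const, Finset.prod_filter, Fintype.prod_prod_type]
    refine Finset.prod_congr rfl fun i _ => Finset.prod_congr rfl fun j _ => ?_
    have : ∀ a b : ZMod 2, a * b = 1 ↔ a = 1 ∧ b = 1 := by decide
    simp only [sgn, this]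
    grind
  rw [h1, h2, ← Finset.prod_mul_distrib]
  refine Finset.prod_congr rfl fun i _ => ?_
  rw [← Finset.prod_mul_distrib]
  refine Finset.prod_congr rfl fun j _ => ?_
  split_ifs
  · rw [sgn_add]
    simp [sgn]
  · simp

theorem list_prod_map_smul {ι n Λ : Type*} [Fintype n] [DecidableEq n] [Ring Λ] [Algebra ℂ Λ]
    (X : ι → Matrix n n ℂ) (ξ : ι → Λ) (l : List ι) :
    (l.map fun a => (X a).map fun z => z • ξ a).prod =
      (l.map X).prod.map fun z => z • (l.map ξ).prod := by
  induction l with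
  | nil =>
    ext i j
    by_cases h : i = j <;> simp [h]
  | cons a l ih =>
    ext i j
    simp [ih, Matrix.mul_apply, Finset.sum_smul, smul_smul, mul_comm]

theorem list_prod_perm_eq {k : ℕ} {Λ : Type*} [Ring Λ] [Algebra ℂ Λ] {px : Fin k → ZMod 2}
    {ξ : Fin k → Λ} (hcomm : ∀ i j, ξ i * ξ j = sgn (1 + px i * px j) • (ξ j * ξ i))
    (σ : Equiv.Perm (Fin k)) :
    ((List.ofFn σ).map ξ).prod =
      (((Equiv.Perm.sign σ : ℤ) : ℂ) * superSign σ px) • ((List.finRange k).map ξ).prod := by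
  rw [list_prod_eq_insertionSort hcomm, inversionSign_ofFn, prod_inversions_eq_sign_mul_superSign]
  congr 3
  refine List.Perm.eq_of_pairwise (le := (· ≤ ·)) (fun a b _ _ => le_antisymm)
    (List.pairwise_insertionSort _ _) (List.pairwise_le_finRange k) ?_
  refine (List.perm_insertionSort _ _).trans ?_
  rw [List.perm_ext_iff_of_nodup (List.nodup_ofFn.mpr σ.injective) (List.nodup_finRange k)]
  intro a
  simpa [List.mem_ofFn] using σ.surjective a

theorem sum_pow_eq_skewPoly_map {k p q : ℕ} {Λ : Type*} [Ring Λ] [Algebra ℂ Λ]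
    {px : Fin k → ZMod 2} {ξ : Fin k → Λ}
    (hcomm : ∀ i j, ξ i * ξ j = sgn (1 + px i * px j) • (ξ j * ξ i))
    (hsq : ∀ i, ξ i * ξ i = 0) (X : Fin k → Matrix (Idx p q) (Idx p q) ℂ) :
    (∑ a, (X a).map fun z => z • ξ a) ^ k =
      (skewPoly X px).map fun z => z • ((List.finRange k).map ξ).prod := by
  have h := (MultilinearMap.mkPiAlgebraFin ℂ k (Matrix (Idx p q) (Idx p q) Λ)).map_sum
    (fun _ a => (X a).map fun z => z • ξ a)
  simp only [MultilinearMap.mkPiAlgebraFin_apply] at h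
  rw [List.ofFn_const, List.prod_replicate] at h
  have hterm : ∀ f : Fin k → Fin k, (List.ofFn fun i => (X (f i)).map fun z => z • ξ (f i)).prod =
      ((List.ofFn f).map X).prod.map fun z => z • ((List.ofFn f).map ξ).prod := fun f => by
    rw [← list_prod_map_smul, List.map_ofFn]
    rfl
  rw [h, ← Finset.sum_of_injOn (s := Finset.univ)
    (f := fun σ : Equiv.Perm (Fin k) =>
      (List.ofFn fun i => (X (σ i)).map fun z => z • ξ (σ i)).prod)
    (fun σ : Equiv.Perm (Fin k) => (σ : Fin k → Fin k)) (DFunLike.coe_injective.injOn)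
    (by simp) ?_ (fun _ _ => rfl)]
  · ext i j
    simp only [hterm, list_prod_perm_eq hcomm, skewPoly, permProd, Matrix.sum_apply,
      Matrix.map_apply, Finset.sum_smul, Matrix.smul_apply, smul_smul]
    refine Finset.sum_congr rfl fun σ _ => ?_
    rw [smul_eq_mul, mul_comm, List.map_ofFn]
    rfl
  · intro f _ hf
    rw [hterm, list_prod_eq_zero_of_not_nodup hcomm hsq]
    · ext
      simp
    · rw [List.nodup_ofFn]
      intro hinj
      exact hf ⟨Equiv.ofBijective f (Finite.injective_iff_bijective.mp hinj), by simp, rfl⟩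

theorem colorSign_add_left (a b c : ZMod 2 × ZMod 2) :
    colorSign (a + b) c = colorSign a c * colorSign b c := by
  rw [colorSign, colorSign, colorSign, ← sgn_add]
  congr 1
  simp only [Prod.fst_add, Prod.snd_add]
  ring

theorem colorSign_comm (a b : ZMod 2 × ZMod 2) : colorSign a b = colorSign b a := by
  rw [colorSign, colorSign, mul_comm a.1, mul_comm a.2]

theorem colorSign_zero_left (a : ZMod 2 × ZMod 2) : colorSign 0 a = 1 := by
  simp [colorSign, sgn]

section generators

variable {ι Λ : Type*} [Ring Λ] [Algebra ℂ Λ]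

/-- The centre of a `ℂ`-algebra is a `ℂ`-algebra. -/
noncomputable instance Subring.center.complexAlgebra : Algebra ℂ (Subring.center Λ) :=
  ((algebraMap ℂ Λ).codRestrict (Subring.center Λ) fun z =>
    Subring.mem_center_iff.mpr fun x => (Algebra.commutes z x).symm).toAlgebra

instance Subring.center.isScalarTower_complex : IsScalarTower ℂ (Subring.center Λ) Λ :=
  IsScalarTower.of_algebraMap_eq fun _ => rfl

/-- The span over the centre of the monomials in `ξ` of a given degree. -/
def monomialSpan (ξ : ι → Λ) (deg : ι → ZMod 2 × ZMod 2) (a : ZMod 2 × ZMod 2) :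
    Submodule (Subring.center Λ) Λ :=
  Submodule.span _ {y | ∃ l : List ι, (l.map deg).sum = a ∧ (l.map ξ).prod = y}

variable {ξ : ι → Λ} {deg : ι → ZMod 2 × ZMod 2}

theorem mem_monomialSpan {ι Λ : Type*} [Ring Λ] {ξ : ι → Λ} {deg : ι → ZMod 2 × ZMod 2} (i : ι) :
    ξ i ∈ monomialSpan ξ deg (deg i) :=
  Submodule.subset_span ⟨[i], by simp, by simp⟩

theorem list_prod_mul_list_prod_eq
    (hcomm : ∀ i j, ξ i * ξ j = colorSign (deg i) (deg j) • (ξ j * ξ i)) (l l' : List ι) :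
    (l.map ξ).prod * (l'.map ξ).prod = colorSign (l.map deg).sum (l'.map deg).sum •
      ((l'.map ξ).prod * (l.map ξ).prod) := by
  have h1 : ∀ (i : ι) (l : List ι), ξ i * (l.map ξ).prod =
      colorSign (deg i) (l.map deg).sum • ((l.map ξ).prod * ξ i) := by
    intro i l
    induction l with
    | nil => simp [colorSign_comm _ 0, colorSign_zero_left]
    | cons j l ih =>
      rw [List.map_cons, List.prod_cons, List.map_cons, List.sum_cons, ← mul_assoc, hcomm,
        smul_mul_assoc, mul_assoc, ih, mul_smul_comm, smul_smul, mul_assoc, colorSign_comm _ (_ + _),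
        colorSign_add_left, colorSign_comm (deg i), colorSign_comm (deg i)]
  induction l with
  | nil => simp [colorSign_zero_left]
  | cons i l ih =>
    rw [List.map_cons, List.prod_cons, List.map_cons, List.sum_cons, mul_assoc, ih, mul_smul_comm,
      ← mul_assoc, h1, smul_mul_assoc, smul_smul, mul_assoc, colorSign_add_left, mul_comm]

theorem colorGrading_monomialSpan
    (hcomm : ∀ i j, ξ i * ξ j = colorSign (deg i) (deg j) • (ξ j * ξ i))
    (hgen : Algebra.adjoin ℂ (Set.range ξ) = ⊤) : ColorGrading (monomialSpan ξ deg) := by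
  have hc : ∀ {a b x y}, x ∈ monomialSpan ξ deg a → y ∈ monomialSpan ξ deg b →
      x * y = colorSign a b • (y * x) := by
    intro a b x y hx hy
    induction hx, hy using Submodule.span_induction₂ with
    | mem_mem x y hx hy =>
      obtain ⟨l, rfl, rfl⟩ := hx
      obtain ⟨l', rfl, rfl⟩ := hy
      exact list_prod_mul_list_prod_eq hcomm l l'
    | zero_left => simp
    | zero_right => simp
    | add_left x y z _ _ _ h1 h2 => rw [add_mul, h1, h2, mul_add, smul_add]
    | add_right x y z _ _ _ h1 h2 => rw [mul_add, h1, h2, add_mul, smul_add]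
    | smul_left r x y _ _ h => rw [smul_mul_assoc, h, mul_smul_comm, smul_comm]
    | smul_right r x y _ _ h => rw [mul_smul_comm, h, smul_mul_assoc, smul_comm]
  refine ⟨?_, hc, Submodule.subset_span ⟨[], rfl, rfl⟩, ?_, Subtype.val_injective⟩
  · intro a b x y hx hy
    induction hx, hy using Submodule.span_induction₂ with
    | mem_mem x y hx hy =>
      obtain ⟨l, rfl, rfl⟩ := hx
      obtain ⟨l', rfl, rfl⟩ := hy
      exact Submodule.subset_span ⟨l ++ l', by simp, by simp⟩
    | zero_left => simp
    | zero_right => simp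
    | add_left x y z _ _ _ h1 h2 => rw [add_mul]; exact add_mem h1 h2
    | add_right x y z _ _ _ h1 h2 => rw [mul_add]; exact add_mem h1 h2
    | smul_left r x y _ _ h => rw [smul_mul_assoc]; exact Submodule.smul_mem _ _ h
    | smul_right r x y _ _ h => rw [mul_smul_comm]; exact Submodule.smul_mem _ _ h
  · intro x hx
    have hle : Algebra.adjoin ℂ (Set.range ξ) ≤ Subalgebra.centralizer ℂ {x} := by
      rw [Algebra.adjoin_le_iff]
      rintro _ ⟨i, rfl⟩
      rw [SetLike.mem_coe, Subalgebra.mem_centralizer_iff]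
      rintro _ rfl
      rw [hc hx (mem_monomialSpan i), colorSign_zero_left, one_smul]
    rw [hgen] at hle
    refine ⟨⟨x, Subring.mem_center_iff.mpr fun y => ?_⟩, rfl⟩
    exact ((Subalgebra.mem_centralizer_iff ℂ).mp (hle (Algebra.mem_top (x := y))) x rfl).symm

/-- The central elements which are nilpotent. -/
noncomputable def nilpotentCenter (Λ : Type*) [Ring Λ] : Submodule (Subring.center Λ) Λ :=
  Submodule.map (Algebra.linearMap (Subring.center Λ) Λ) (nilradical (Subring.center Λ))

theorem isNilpotent_of_mem_nilpotentCenter {Λ : Type*} [Ring Λ] {x : Λ} (hx : x ∈ nilpotentCenter Λ) :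
    IsNilpotent x := by
  obtain ⟨r, hr, rfl⟩ := hx
  exact (mem_nilradical.mp hr).map (algebraMap (Subring.center Λ) Λ)

theorem mul_mem_nilpotentCenter [Fintype ι]
    (hcomm : ∀ i j, ξ i * ξ j = colorSign (deg i) (deg j) • (ξ j * ξ i))
    (hsq : ∀ i, ξ i * ξ i = 0) (hgen : Algebra.adjoin ℂ (Set.range ξ) = ⊤)
    {d : ZMod 2 × ZMod 2} {x y : ι → ℂ} (hx : ∀ i, deg i ≠ d → x i = 0)
    (hy : ∀ i, deg i ≠ d → y i = 0) :
    (∑ i, x i • ξ i) * ∑ i, y i • ξ i ∈ nilpotentCenter Λ := by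
  have hG := colorGrading_monomialSpan hcomm hgen
  rw [Finset.sum_mul_sum]
  refine Submodule.sum_mem _ fun i _ => Submodule.sum_mem _ fun j _ => ?_
  by_cases hi : deg i = d
  · by_cases hj : deg j = d
    · obtain ⟨r, hr⟩ := hG.exists_algebraMap (x := ξ i * ξ j) (by
        have := hG.mul_mem (mem_monomialSpan (ξ := ξ) (deg := deg) i) (mem_monomialSpan j)
        rwa [hi, hj, CharTwo.add_self_eq_zero] at this)
      rw [smul_mul_smul_comm]
      refine Submodule.smul_of_tower_mem _ _ ⟨r, mem_nilradical.mpr ⟨2, hG.injective ?_⟩, hr⟩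
      rw [map_pow, hr, map_zero, sq, ← mul_assoc, mul_assoc (ξ i), hcomm j i, mul_smul_comm,
        smul_mul_assoc, ← mul_assoc, hsq, zero_mul, zero_mul, smul_zero]
    · rw [hy j hj, zero_smul, mul_zero]
      exact zero_mem _
  · rw [hx i hi, zero_smul, zero_mul]
    exact zero_mem _

end generators

section model

variable {k : ℕ}

/-- A creation operator on functions on subsets of `Fin k`. -/
noncomputable def creation (ε : Fin k → Fin k → ℂ) (i : Fin k) :
    Module.End ℂ (Finset (Fin k) → ℂ) where
  toFun f S := if i ∈ S then (∏ j ∈ S.erase i, if j < i then ε i j else 1) * f (S.erase i) else 0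
  map_add' f g := by
    ext S
    simp only [Pi.add_apply]
    split_ifs <;> ring
  map_smul' c f := by
    ext S
    simp only [Pi.smul_apply, smul_eq_mul, RingHom.id_apply]
    split_ifs <;> ring

theorem creation_mul_self (ε : Fin k → Fin k → ℂ) (i : Fin k) :
    creation ε i * creation ε i = 0 := by
  ext f S
  simp [creation]

theorem creation_mul_creation {ε : Fin k → Fin k → ℂ} (hε : ∀ i j, ε i j * ε j i = 1)
    (i j : Fin k) : creation ε i * creation ε j = ε i j • (creation ε j * creation ε i) := by
  by_cases hij : i = j
  · subst hij
    rw [creation_mul_self, smul_zero]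
  refine LinearMap.ext fun f => funext fun S => ?_
  simp only [creation, Module.End.mul_apply, LinearMap.smul_apply, LinearMap.coe_mk,
    AddHom.coe_mk, Pi.smul_apply, smul_eq_mul, Finset.mem_erase]
  by_cases hi : i ∈ S
  · by_cases hj : j ∈ S
    · have h1 : S.erase i = insert j ((S.erase i).erase j) :=
        (Finset.insert_erase (Finset.mem_erase.mpr ⟨Ne.symm hij, hj⟩)).symm
      have h2 : S.erase j = insert i ((S.erase i).erase j) := by
        rw [Finset.erase_right_comm]
        exact (Finset.insert_erase (Finset.mem_erase.mpr ⟨hij, hi⟩)).symm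
      rw [if_pos hi, if_pos ⟨Ne.symm hij, hj⟩, if_pos hj, if_pos ⟨hij, hi⟩,
        Finset.erase_right_comm (a := j) (b := i)]
      have h3 : (∏ l ∈ S.erase i, if l < i then ε i l else 1) = (if j < i then ε i j else 1) *
          ∏ l ∈ (S.erase i).erase j, if l < i then ε i l else 1 := by
        conv_lhs => rw [h1]
        rw [Finset.prod_insert (by simp)]
      have h4 : (∏ l ∈ S.erase j, if l < j then ε j l else 1) = (if i < j then ε j i else 1) *
          ∏ l ∈ (S.erase i).erase j, if l < j then ε j l else 1 := by
        rw [h2, Finset.prod_insert (by simp)]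
      rw [h3, h4]
      rcases lt_or_gt_of_ne hij with h | h
      · rw [if_neg h.not_gt, if_pos h]
        linear_combination (-(∏ l ∈ (S.erase i).erase j, if l < i then ε i l else 1) *
          (∏ l ∈ (S.erase i).erase j, if l < j then ε j l else 1) *
            f ((S.erase i).erase j)) * hε i j
      · rw [if_neg h.not_gt, if_pos h]
        ring
    · simp [hj]
  · simp [hi]

theorem creation_list_prod_apply_ne_zero {ε : Fin k → Fin k → ℂ} (hε : ∀ i j, ε i j * ε j i = 1)
    {l : List (Fin k)} (hl : l.Nodup) :
    (l.map (creation ε)).prod (Pi.single ∅ 1) l.toFinset ≠ 0 := by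
  induction l with
  | nil => simp
  | cons a l ih =>
    obtain ⟨ha, hl⟩ := List.nodup_cons.mp hl
    rw [List.map_cons, List.prod_cons, Module.End.mul_apply, List.toFinset_cons]
    simp only [creation, LinearMap.coe_mk, AddHom.coe_mk, Finset.mem_insert_self, if_true,
      Finset.erase_insert (List.mem_toFinset.not.mpr ha)]
    refine mul_ne_zero (Finset.prod_ne_zero_iff.mpr fun j _ => ?_) (ih hl)
    split_ifs
    · exact left_ne_zero_of_mul_eq_one (hε a j)
    · exact one_ne_zero

theorem exists_algebra_of_commutation_factor {ε : Fin k → Fin k → ℂ}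
    (hε : ∀ i j, ε i j * ε j i = 1) :
    ∃ (Λ : Type) (_ : Ring Λ) (_ : Algebra ℂ Λ) (ξ : Fin k → Λ),
      (∀ i j, ξ i * ξ j = ε i j • (ξ j * ξ i)) ∧ (∀ i, ξ i * ξ i = 0) ∧
      Algebra.adjoin ℂ (Set.range ξ) = ⊤ ∧ ((List.finRange k).map ξ).prod ≠ 0 := by
  let S := Algebra.adjoin ℂ (Set.range (creation ε))
  let ξ : Fin k → S := fun i => ⟨creation ε i, Algebra.subset_adjoin ⟨i, rfl⟩⟩
  refine ⟨S, inferInstance, inferInstance, ξ,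
    fun i j => Subtype.ext (creation_mul_creation hε i j),
    fun i => Subtype.ext (creation_mul_self ε i), ?_, fun h => ?_⟩
  · have hξ : Set.range ξ = Subtype.val ⁻¹' Set.range (creation ε) := by
      ext x
      simp [ξ, Subtype.ext_iff]
    rw [hξ]
    exact Algebra.adjoin_adjoin_coe_preimage
  · have h2 := congrArg (S.val) h
    rw [map_list_prod, List.map_map, map_zero] at h2
    refine creation_list_prod_apply_ne_zero hε (List.nodup_finRange k) ?_
    have h3 : (⇑S.val ∘ ξ) = creation ε := rfl
    rw [← h3, h2]
    rfl

end model

section orthosymplectic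

variable {n : ℕ}

/-- The matrix of the symplectic form on the odd part. -/
noncomputable def oddForm (n : ℕ) : Matrix (Fin (2 * n)) (Fin (2 * n)) ℂ :=
  (Bmat n).toBlocks₂₂

theorem oddForm_apply (i j : Fin (2 * n)) : oddForm n i j =
    if i.val + n = j.val then 1 else if j.val + n = i.val then -1 else 0 := rfl

theorem oddForm_antisymm (hn : 1 ≤ n) (i j : Fin (2 * n)) : oddForm n j i = -oddForm n i j := by
  simp only [oddForm_apply]
  split_ifs <;> first | omega | simp

theorem isUnit_det_oddForm (hn : 1 ≤ n) : IsUnit (oddForm n).det := by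
  have h : oddForm n * (oddForm n)ᵀ = 1 := by
    ext i j
    rw [Matrix.mul_apply, Matrix.one_apply]
    rcases lt_or_ge i.val n with hi | hi
    · rw [Finset.sum_eq_single ⟨i + n, by omega⟩]
      · simp only [oddForm_apply, Matrix.transpose_apply, Fin.ext_iff]
        split_ifs <;> first | omega | simp
      · intro k _ hk
        rw [ne_eq, Fin.ext_iff] at hk
        simp only at hk
        rw [oddForm_apply, if_neg (by omega), if_neg (by omega), zero_mul]
      · simp
    · rw [Finset.sum_eq_single ⟨i - n, by omega⟩]
      · simp only [oddForm_apply, Matrix.transpose_apply, Fin.ext_iff]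
        split_ifs <;> first | omega | simp
      · intro k _ hk
        rw [ne_eq, Fin.ext_iff] at hk
        simp only at hk
        rw [oddForm_apply, if_neg (by omega), if_neg (by omega), zero_mul]
      · simp
  exact Matrix.isUnit_det_of_right_inverse h

theorem ospMem.sum_add_sum_eq_zero {X : Matrix (Idx 1 (2 * n)) (Idx 1 (2 * n)) ℂ} {ε : ZMod 2}
    (hX : ospMem X ε) (p q : Idx 1 (2 * n)) :
    ∑ i, X i p * Bmat n i q + sgn (ε * ipar p) * ∑ j, Bmat n p j * X j q = 0 := by
  have hpar : ∀ p : Idx 1 (2 * n), VHasParity (Pi.single p 1) (ipar p) := fun p i hi =>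
    Pi.single_eq_of_ne (fun h => hi (congrArg ipar h)) _
  have h := hX.2 (Pi.single p 1) (Pi.single q 1) _ _ (hpar p) (hpar q)
  simpa [Bform, Pi.single_apply] using h

theorem ospMem.apply_inl_inl {X : Matrix (Idx 1 (2 * n)) (Idx 1 (2 * n)) ℂ} {ε : ZMod 2}
    (hX : ospMem X ε) (i j : Fin 1) : X (Sum.inl i) (Sum.inl j) = 0 := by
  have h := hX.sum_add_sum_eq_zero (Sum.inl 0) (Sum.inl 0)
  rw [Subsingleton.elim i 0, Subsingleton.elim j 0]
  apply eq_zero_of_eq_neg_self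
  apply eq_neg_of_add_eq_zero_left
  simpa [Bmat, ipar, sgn] using h

theorem ospMem.apply_inl_inr {X : Matrix (Idx 1 (2 * n)) (Idx 1 (2 * n)) ℂ} {ε : ZMod 2}
    (hX : ospMem X ε) (j : Fin (2 * n)) : X (Sum.inl 0) (Sum.inr j) =
      -∑ i, oddForm n i j * X (Sum.inr i) (Sum.inl 0) := by
  have h := hX.sum_add_sum_eq_zero (Sum.inl 0) (Sum.inr j)
  apply eq_neg_of_add_eq_zero_right
  simpa [Bmat, ipar, sgn, oddForm_apply, mul_comm] using h

theorem ospMem.sum_oddForm_add_sum_oddForm {X : Matrix (Idx 1 (2 * n)) (Idx 1 (2 * n)) ℂ}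
    {ε : ZMod 2} (hX : ospMem X ε) (i j : Fin (2 * n)) :
    ∑ k, oddForm n k j * X (Sum.inr k) (Sum.inr i) +
      ∑ k, oddForm n i k * X (Sum.inr k) (Sum.inr j) = 0 := by
  by_cases hε : ε = 1
  · have h0 : ∀ k l, X (Sum.inr k) (Sum.inr l) = 0 := fun k l => hX.1 _ _ (by simp [ipar, hε])
    simp [h0]
  · have h := hX.sum_add_sum_eq_zero (Sum.inr i) (Sum.inr j)
    simpa [Bmat, ipar, sgn, oddForm_apply, mul_comm, hε] using h

end orthosymplectic

theorem sum_smul_mem_monomialSpan {ι Λ : Type*} [Fintype ι] [Ring Λ] [Algebra ℂ Λ] {ξ : ι → Λ}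
    {deg : ι → ZMod 2 × ZMod 2} {d : ZMod 2 × ZMod 2} {x : ι → ℂ}
    (hx : ∀ i, deg i ≠ d → x i = 0) : ∑ i, x i • ξ i ∈ monomialSpan ξ deg d := by
  refine Submodule.sum_mem _ fun i _ => ?_
  by_cases hi : deg i = d
  · rw [← hi]
    exact Submodule.smul_of_tower_mem _ _ (mem_monomialSpan i)
  · rw [hx i hi, zero_smul]
    exact zero_mem _

theorem sum_osp_pow_eq_zero {ι Λ : Type*} [Fintype ι] [Ring Λ] [Algebra ℂ Λ] {n : ℕ} (hn : 1 ≤ n)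
    {X : ι → Matrix (Idx 1 (2 * n)) (Idx 1 (2 * n)) ℂ} {px : ι → ZMod 2}
    (hX : ∀ a, ospMem (X a) (px a)) {ξ : ι → Λ}
    (hcomm : ∀ i j, ξ i * ξ j = colorSign (1, px i) (1, px j) • (ξ j * ξ i))
    (hsq : ∀ i, ξ i * ξ i = 0) (hgen : Algebra.adjoin ℂ (Set.range ξ) = ⊤) :
    (∑ a, (X a).map fun z => z • ξ a) ^ (4 * n + 2) = 0 := by
  have hone : ∀ p q : Fin (2 * n), ∀ a, ((1, px a) : ZMod 2 × ZMod 2) ≠ (1, 0) →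
      X a (Sum.inr p) (Sum.inr q) = 0 := fun p q a ha =>
    (hX a).1 _ _ (by simpa [ipar] using ha)
  have hinl : ∀ p : Fin (2 * n), ∀ a, ((1, px a) : ZMod 2 × ZMod 2) ≠ (1, 1) →
      X a (Sum.inr p) (Sum.inl 0) = 0 := fun p a ha =>
    (hX a).1 _ _ (by simpa [ipar, eq_comm] using ha)
  have hinr : ∀ p : Fin (2 * n), ∀ a, ((1, px a) : ZMod 2 × ZMod 2) ≠ (1, 1) →
      X a (Sum.inl 0) (Sum.inr p) = 0 := fun p a ha =>
    (hX a).1 _ _ fun h => ha (by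
      rw [ipar, ipar] at h
      rw [Prod.mk.injEq]
      exact ⟨rfl, by generalize px a = z at h; revert z; decide⟩)
  set b : Fin (2 * n) → Λ := fun j => ∑ a, X a (Sum.inl 0) (Sum.inr j) • ξ a with hb
  set c : Fin (2 * n) → Λ := fun i => ∑ a, X a (Sum.inr i) (Sum.inl 0) • ξ a with hc
  set D : Matrix (Fin (2 * n)) (Fin (2 * n)) Λ :=
    fun i j => ∑ a, X a (Sum.inr i) (Sum.inr j) • ξ a with hD
  have hA : (∑ a, (X a).map fun z => z • ξ a) = bordered b c D := by
    ext i j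
    rcases i with i | i <;> rcases j with j | j
    · simp [bordered, Matrix.sum_apply, (hX _).apply_inl_inl]
    · simp [bordered, Matrix.sum_apply, hb, Subsingleton.elim i 0]
    · simp [bordered, Matrix.sum_apply, hc, Subsingleton.elim j 0]
    · simp only [bordered, Matrix.fromBlocks_apply₂₂, Matrix.sum_apply, Matrix.map_apply]
      rfl
  have h := (colorGrading_monomialSpan hcomm hgen).osp_pow_eq_zero (J := oddForm n) (b := b)
    (c := c) (D := D) (isUnit_det_oddForm hn) (oddForm_antisymm hn)
    (fun i => sum_smul_mem_monomialSpan (hinl i))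
    (fun i j => sum_smul_mem_monomialSpan (hone i j)) (fun j => ?_) (fun i j => ?_)
    (fun i j => isNilpotent_of_mem_nilpotentCenter (add_mem ?_
      (Submodule.sum_mem _ fun k _ => ?_)))
  · rw [hA, ← h, Fintype.card_fin]
    congr 1
    ring
  · simp only [hb, hc, (hX _).apply_inl_inr, neg_smul, Finset.sum_neg_distrib, Finset.sum_smul,
      Finset.smul_sum, smul_smul]
    rw [Finset.sum_comm]
  · simp only [hD, Finset.smul_sum, smul_smul]
    refine (congrArg₂ (· + ·) Finset.sum_comm Finset.sum_comm).trans ?_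
    rw [← Finset.sum_add_distrib]
    refine Finset.sum_eq_zero fun a _ => ?_
    rw [← Finset.sum_smul, ← Finset.sum_smul, ← add_smul, (hX a).sum_oddForm_add_sum_oddForm,
      zero_smul]
  · exact mul_mem_nilpotentCenter hcomm hsq hgen (hinl i) (hinr j)
  · exact mul_mem_nilpotentCenter hcomm hsq hgen (hone i k) (hone k j)

/-- The super Amitsur–Levitzki theorem for `osp(1,2n)`:
`𝒜_{4n+2}(X₁,…,X_{4n+2}) = 0` for homogeneous `Xᵢ ∈ osp(1,2n)`. -/
theorem super_amitsur_levitzki_osp (n : ℕ) (hn : 1 ≤ n)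
    (X : Fin (4*n+2) → Matrix (Idx 1 (2*n)) (Idx 1 (2*n)) ℂ)
    (px : Fin (4*n+2) → ZMod 2) (hX : ∀ i, ospMem (X i) (px i)) :
    skewPoly X px = 0 := by
  obtain ⟨Λ, _, _, ξ, hcomm, hsq, hgen, hω⟩ := exists_algebra_of_commutation_factor
    (ε := fun i j => sgn (1 + px i * px j))
    (fun i j => by rw [mul_comm (px j), sgn_mul_self])
  have h := sum_pow_eq_skewPoly_map hcomm hsq X
  rw [sum_osp_pow_eq_zero hn hX (fun i j => by rw [hcomm, colorSign, mul_one]) hsq hgen] at h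
  ext i j
  have hij := congrFun (congrFun h i) j
  rw [Matrix.zero_apply, Matrix.map_apply, eq_comm, smul_eq_zero] at hij
  exact hij.resolve_right hω
end

section
/- (Amitsur–Levitzki) For all n×n complex matrices X₁, …, X_{2n}, the standard polynomial of order 2n vanishes: Σ_{σ∈S_{2n}} ε(σ) X_{σ(1)}⋯X_{σ(2n)} = 0. -/
namespace Matrix

open Polynomial

variable {m R : Type*} [Fintype m] [DecidableEq m] [CommRing R]

/-- **Jacobi's formula** for matrices of polynomials. -/
theorem derivative_det (M : Matrix m m R[X]) :
    derivative M.det = (M.map derivative * M.adjugate).trace := by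
  have key (i : m) : ∑ j, derivative (M i j) * M.adjugate j i =
      ∑ σ : Equiv.Perm m, (Equiv.Perm.sign σ : ℤ) •
        ((∏ k ∈ Finset.univ.erase i, M k (σ k)) * derivative (M i (σ i))) := by
    have hdet := det_eq_sum_mul_adjugate_row (M.updateRow i fun j => derivative (M i j)) i
    simp only [updateRow_self, adjugate_apply, updateRow_idem] at hdet
    simp only [adjugate_apply]
    rw [← hdet, ← det_transpose, det_apply]
    refine Finset.sum_congr rfl fun σ _ => ?_
    rw [Units.smul_def, ← Finset.prod_erase_mul _ _ (Finset.mem_univ i)]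
    simp only [transpose_apply, updateRow_self]
    congr 2
    refine Finset.prod_congr rfl fun k hk => ?_
    rw [updateRow_ne (Finset.ne_of_mem_erase hk)]
  simp only [trace, diag_apply, mul_apply, map_apply, key]
  rw [Finset.sum_comm, ← det_transpose, det_apply, map_sum]
  refine Finset.sum_congr rfl fun σ _ => ?_
  simp only [transpose_apply]
  rw [Units.smul_def, map_zsmul, derivative_prod_finset, Finset.smul_sum]

/-- A matrix over a torsion-free commutative ring all of whose powers have trace zero is
nilpotent. -/
theorem pow_card_eq_zero_of_trace_pow_eq_zero [IsAddTorsionFree R] (A : Matrix m m R)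
    (hA : ∀ k, (A ^ (k + 1)).trace = 0) : A ^ Fintype.card m = 0 := by
  nontriviality R
  set B : Matrix m m R[X] := A.map C with hB
  set M : Matrix m m R[X] := 1 - (X : R[X]) • B with hM
  have htr (k : ℕ) : (B ^ (k + 1)).trace = 0 := by
    have : B ^ (k + 1) = (A ^ (k + 1)).map C := (map_pow C.mapMatrix A (k + 1)).symm
    rw [this, trace]
    simp only [diag_apply, map_apply, ← map_sum]
    exact (congrArg C (hA k)).trans C_0
  have hadj : M.adjugate = M.det • (1 : Matrix m m R[X]) + (X : R[X]) • (B * M.adjugate) := by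
    rw [← mul_adjugate M, ← smul_mul_assoc, ← add_mul]
    simp [hM]
  have hstep (k : ℕ) : (B ^ (k + 1) * M.adjugate).trace =
      X * (B ^ (k + 2) * M.adjugate).trace := by
    conv_lhs => rw [hadj]
    rw [mul_add, trace_add, mul_smul_comm, mul_one, trace_smul, htr, mul_smul_comm, trace_smul,
      ← mul_assoc, ← pow_succ]
    simp
  have hdvd (k : ℕ) : (B * M.adjugate).trace = X ^ k * (B ^ (k + 1) * M.adjugate).trace := by
    induction k with
    | zero => simp
    | succ k ih => rw [ih, hstep, pow_succ X, mul_assoc]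
  have hzero : (B * M.adjugate).trace = 0 := by
    ext d
    rw [hdvd (d + 1), coeff_X_pow_mul']
    simp
  have hder : derivative A.charpolyRev = 0 := by
    have : M.map derivative = -B := by
      ext1 i j
      by_cases h : i = j <;> simp [hM, hB, h]
    change derivative M.det = 0
    rw [derivative_det, this, neg_mul, trace_neg, hzero, neg_zero]
  have hrev : A.charpolyRev = 1 := by
    have h := eq_C_of_natDegree_eq_zero (derivative_eq_zero.mp hder)
    rw [h, coeff_zero_eq_eval_zero, eval_charpolyRev, C_1]
  have hchar : A.charpoly = X ^ Fintype.card m := by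
    rw [← reverse_charpoly, reverse, charpoly_natDegree_eq_dim] at hrev
    rw [← reflect_reflect (N := Fintype.card m) (p := A.charpoly), hrev, reflect_one]
  simpa [hchar] using aeval_self_charpoly A

end Matrix

namespace ExteriorAlgebra

variable {R M : Type*} [CommRing R] [AddCommGroup M] [Module R M]

theorem ι_mul_ι_comm (a b : M) : ι R a * ι R b = -(ι R b * ι R a) :=
  eq_neg_of_add_eq_zero_left (ι_add_mul_swap a b)

theorem commute_ι_mul_ι_ι (a b c : M) : Commute (ι R a * ι R b) (ι R c) := by
  rw [Commute, SemiconjBy, mul_assoc, ι_mul_ι_comm b c, mul_neg, ← mul_assoc, ι_mul_ι_comm a c,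
    neg_mul, neg_neg, mul_assoc]

variable (R M) in
/-- The subalgebra generated by the products of two vectors; it is central. -/
def adjoinιMulι : Subalgebra R (ExteriorAlgebra R M) :=
  Algebra.adjoin R (Set.range fun v : M × M => ι R v.1 * ι R v.2)

theorem ι_mul_ι_mem (a b : M) : ι R a * ι R b ∈ adjoinιMulι R M :=
  Algebra.subset_adjoin ⟨(a, b), rfl⟩

theorem commute_ι_of_mem {s : ExteriorAlgebra R M} (hs : s ∈ adjoinιMulι R M) (c : M) :
    Commute s (ι R c) := by
  induction hs using Algebra.adjoin_induction with
  | mem x hx =>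
    obtain ⟨v, rfl⟩ := hx
    exact commute_ι_mul_ι_ι _ _ _
  | algebraMap r => exact Algebra.commutes r _
  | add x y _ _ hx hy => exact hx.add_left hy
  | mul x y _ _ hx hy => exact hx.mul_left hy

instance : IsMulCommutative (adjoinιMulι R M) :=
  Algebra.isMulCommutative_adjoin R <| by
    rintro _ ⟨v, rfl⟩ _ ⟨w, rfl⟩
    exact (commute_ι_mul_ι_ι _ _ _).mul_right (commute_ι_mul_ι_ι _ _ _)

open scoped IsMulCommutative in
/-- A matrix of vectors in the exterior algebra satisfies the conclusion of the
**Amitsur–Levitzki theorem**. -/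
theorem matrix_ι_pow_two_mul_card_eq_zero [Algebra ℚ R] {m : Type*} [Fintype m] [DecidableEq m]
    (v : Matrix m m M) : v.map (ι R) ^ (2 * Fintype.card m) = 0 := by
  set A : Matrix m m (ExteriorAlgebra R M) := v.map (ι R) with hA
  let B : Matrix m m (adjoinιMulι R M) := fun i j =>
    ∑ k, ⟨ι R (v i k) * ι R (v k j), ι_mul_ι_mem _ _⟩
  have hB : (adjoinιMulι R M).val.mapMatrix B = A ^ 2 := by
    ext i j
    rw [AlgHom.mapMatrix_apply, Matrix.map_apply, pow_two, Matrix.mul_apply]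
    simp [B, hA]
  have hBpow (k : ℕ) : (adjoinιMulι R M).val.mapMatrix (B ^ k) = A ^ (2 * k) := by
    rw [map_pow, hB, pow_mul]
  have hswap (k : ℕ) (i j p q : m) :
      (A * A ^ (2 * k)) i j * A p q = -(A p q * (A * A ^ (2 * k)) i j) := by
    rw [← hBpow, Matrix.mul_apply, Finset.sum_mul, Finset.mul_sum, ← Finset.sum_neg_distrib]
    refine Finset.sum_congr rfl fun l _ => ?_
    have hc := commute_ι_of_mem ((B ^ k) l j).2 (v p q)
    simp only [hA, Matrix.map_apply, AlgHom.mapMatrix_apply, Subalgebra.coe_val]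
    rw [mul_assoc, hc.eq, ← mul_assoc, ι_mul_ι_comm, neg_mul, mul_assoc]
  have htrace (k : ℕ) : (A ^ (2 * (k + 1))).trace = 0 := by
    have h : (A * (A * A ^ (2 * k))).trace = -((A * A ^ (2 * k)) * A).trace := by
      simp only [Matrix.trace, Matrix.diag_apply, Matrix.mul_apply (M := A * A ^ (2 * k)), hswap,
        Matrix.mul_apply (M := A) (N := A * A ^ (2 * k)), Finset.sum_neg_distrib, neg_neg]
      exact Finset.sum_comm
    have h1 : A * (A * A ^ (2 * k)) = A ^ (2 * (k + 1)) := by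
      rw [← pow_succ', ← pow_succ']; rfl
    have h2 : A * A ^ (2 * k) * A = A ^ (2 * (k + 1)) := by
      rw [← pow_succ', ← pow_succ]; rfl
    rw [h1, h2] at h
    have : Module ℚ (ExteriorAlgebra R M) := Module.compHom _ (algebraMap ℚ R)
    have : IsAddTorsionFree (ExteriorAlgebra R M) := .of_module_rat _
    exact self_eq_neg.mp h
  have : Module ℚ (adjoinιMulι R M) := Module.compHom _ (algebraMap ℚ R)
  have : IsAddTorsionFree (adjoinιMulι R M) := .of_module_rat _
  rw [← hBpow, Matrix.pow_card_eq_zero_of_trace_pow_eq_zero B, map_zero]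
  intro k
  apply Subtype.val_injective
  have := htrace k
  rw [← hBpow] at this
  simpa [Matrix.trace] using this

theorem prod_ofFn_ι_smul {m : Type*} [Fintype m] [DecidableEq m] {k : ℕ} (e : Fin k → M)
    (X : Fin k → Matrix m m R) :
    (List.ofFn fun i => ι R (e i) • (X i).map (algebraMap R (ExteriorAlgebra R M))).prod =
      ιMulti R k e • ((List.ofFn X).prod).map (algebraMap R (ExteriorAlgebra R M)) := by
  induction k with
  | zero => simp [Matrix.map_one]
  | succ k ih =>
    rw [List.ofFn_succ, List.prod_cons, ih, List.ofFn_succ, List.prod_cons, ιMulti_succ_apply]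
    ext i j
    simp only [Matrix.mul_apply, Matrix.smul_apply, Matrix.map_apply, smul_eq_mul, map_sum,
      map_mul, Finset.mul_sum]
    refine Finset.sum_congr rfl fun l _ => ?_
    rw [mul_assoc, ← mul_assoc (algebraMap R _ _), Algebra.commutes (X 0 i l)]
    simp only [mul_assoc, Matrix.vecTail, Function.comp_def]

end ExteriorAlgebra

/-- The Amitsur–Levitzki theorem: for all `n × n` complex matrices
`X₁, …, X_{2n}`, the standard polynomial of order `2n` vanishes:
`Σ_{σ ∈ S_{2n}} ε(σ) X_{σ(1)} ⋯ X_{σ(2n)} = 0`. -/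
theorem amitsur_levitzki (n : ℕ) (X : Fin (2*n) → Matrix (Fin n) (Fin n) ℂ) :
    ∑ σ : Equiv.Perm (Fin (2*n)),
      (((Equiv.Perm.sign σ : ℤ) : ℂ)) • (List.ofFn fun i => X (σ i)).prod = 0 := by
  let e (k : Fin (2 * n)) : Fin (2 * n) → ℂ := Pi.single k 1
  let A := algebraMap ℂ (ExteriorAlgebra ℂ (Fin (2 * n) → ℂ))
  have hsum : (Matrix.of fun i j k => X k i j).map (ExteriorAlgebra.ι ℂ) =
      ∑ k, ExteriorAlgebra.ι ℂ (e k) • (X k).map A := by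
    ext1 i j
    have h : (fun k => X k i j) = ∑ k, X k i j • e k := by
      ext l
      simp [e, Pi.single_apply]
    rw [Matrix.map_apply, Matrix.of_apply, h, map_sum, Matrix.sum_apply]
    refine Finset.sum_congr rfl fun k _ => ?_
    rw [map_smul, Algebra.smul_def, Algebra.commutes]
    rfl
  have hpow := ExteriorAlgebra.matrix_ι_pow_two_mul_card_eq_zero (R := ℂ)
    (Matrix.of fun i j k => X k i j)
  rw [hsum, Fintype.card_fin, ← MultilinearMap.mkPiAlgebraFin_apply_const (R := ℂ),
    MultilinearMap.map_sum] at hpow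
  simp only [MultilinearMap.mkPiAlgebraFin_apply, A, ExteriorAlgebra.prod_ofFn_ι_smul] at hpow
  let φ := ExteriorAlgebra.liftAlternating (R := ℂ) (M := Fin (2 * n) → ℂ)
    (Pi.single (2 * n) (Matrix.detRowAlternating (n := Fin (2 * n)) (R := ℂ)))
  have hφ (f : Fin (2 * n) → Fin (2 * n)) : φ (ExteriorAlgebra.ιMulti ℂ (2 * n) fun i => e (f i)) =
      Matrix.detRowAlternating fun i => e (f i) := by
    simp [φ, ExteriorAlgebra.liftAlternating_apply_ιMulti]
  ext i j
  have hij := congrArg φ (congrFun (congrFun hpow i) j)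
  rw [Matrix.sum_apply, map_sum, Matrix.zero_apply, map_zero] at hij
  rw [Matrix.sum_apply, Matrix.zero_apply, ← hij]
  refine Fintype.sum_of_injective (fun σ : Equiv.Perm (Fin (2 * n)) => ⇑σ)
    DFunLike.coe_injective _ _ (fun f hf => ?_) fun σ => ?_
  · have hinj : ¬ Function.Injective f := fun h =>
      hf ⟨Equiv.ofBijective f (Finite.injective_iff_bijective.mp h), rfl⟩
    rw [ExteriorAlgebra.ιMulti_eq_zero_of_not_inj]
    · simp
    · exact fun h => hinj (Function.Injective.of_comp (f := e) h)
  · rw [Matrix.smul_apply, Matrix.smul_apply, Matrix.map_apply, smul_eq_mul, smul_eq_mul,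
      ← Algebra.commutes, ← Algebra.smul_def, map_smul, hφ, smul_eq_mul, mul_comm]
    have hσ := AlternatingMap.map_perm (Matrix.detRowAlternating (R := ℂ)) e σ
    have : Matrix.detRowAlternating e = (1 : ℂ) := by
      have he : Matrix.of e = 1 := by
        ext a b
        simp [e, Matrix.one_apply, Pi.single_apply, eq_comm]
      exact (congrArg Matrix.det he).trans Matrix.det_one
    rw [this, Units.smul_def, zsmul_one] at hσ
    exact congrArg _ hσ.symm
end

section
/- Suppose p ≥ 1 and q ≥ 1. Then for every k ≥ 1 there exists an odd matrix X ∈ gl(p,q) such that 𝒜_k(X, …, X) ≠ 0. In particular, gl(p,q) satisfies no standard super polynomial identity. -/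
open Matrix

theorem sign_mul_superSign_one {k : ℕ} (σ : Equiv.Perm (Fin k)) :
    ((Equiv.Perm.sign σ : ℤ) : ℂ) * superSign σ (fun _ => 1) = 1 := by
  have key : ((Equiv.Perm.sign σ : ℤ) : ℂ) = superSign σ (fun _ => 1) := by
    rw [Equiv.Perm.sign_eq_prod_prod_Ioi, superSign, ← Finset.prod_const, Finset.prod_filter,
      ← Finset.univ_product_univ, Finset.prod_product]
    push_cast
    refine Finset.prod_congr rfl fun i _ => ?_
    rw [← Finset.prod_subset (Finset.subset_univ (Finset.Ioi i))]
    · refine Finset.prod_congr rfl fun j hj => ?_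
      have hij : i < j := Finset.mem_Ioi.mp hj
      have hne : σ i ≠ σ j := fun h => hij.ne (σ.injective h)
      rcases lt_or_gt_of_ne hne with h | h
      · simp [h, h.not_gt]
      · simp [h, h.not_gt, hij]
    · intro j _ hj
      simp_all
  rw [key, superSign, ← mul_pow]
  simp

theorem skewPoly_const_one {k p q : ℕ} (X : Matrix (Idx p q) (Idx p q) ℂ) :
    skewPoly (fun _ : Fin k => X) (fun _ => 1) = (k.factorial : ℂ) • X ^ k := by
  simp [Nat.cast_smul_eq_nsmul, skewPoly, sign_mul_superSign_one, permProd, Fintype.card_perm]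

theorem pow_ne_zero_of_mulVec_eq_self {n R : Type*} [Fintype n] [DecidableEq n] [Semiring R]
    {X : Matrix n n R} {v : n → R} (hv : v ≠ 0) (h : X *ᵥ v = v) (k : ℕ) : X ^ k ≠ 0 := by
  have hk : X ^ k *ᵥ v = v := by
    induction k with
    | zero => simp
    | succ k ih => rw [pow_succ, ← Matrix.mulVec_mulVec, h, ih]
  intro h0
  rw [h0, Matrix.zero_mulVec] at hk
  exact hv hk.symm

/-- If `p, q ≥ 1` then for each `k ≥ 1` there is an odd `X ∈ gl(p,q)` with
`𝒜_k(X,…,X) ≠ 0`: `gl(p,q)` satisfies no standard super polynomial identity. -/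
theorem no_standard_super_identity_gl (p q : ℕ) (hp : 1 ≤ p) (hq : 1 ≤ q)
    (k : ℕ) (hk : 1 ≤ k) :
    ∃ X : Matrix (Idx p q) (Idx p q) ℂ, HasParity X 1 ∧
      skewPoly (fun _ : Fin k => X) (fun _ => 1) ≠ 0 := by
  let X : Matrix (Idx p q) (Idx p q) ℂ := Matrix.fromBlocks 0
    (.of fun _ b => if b = ⟨0, hq⟩ then 1 else 0)
    (.of fun _ a => if a = ⟨0, hp⟩ then 1 else 0) 0
  refine ⟨X, ?_, ?_⟩
  · rintro (i | i) (j | j) h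
    · rfl
    · exact absurd (by decide : (0 : ZMod 2) = 1 + 1) h
    · exact absurd (by decide : (1 : ZMod 2) = 0 + 1) h
    · rfl
  · rw [skewPoly_const_one]
    refine smul_ne_zero (Nat.cast_ne_zero.mpr k.factorial_ne_zero)
      (pow_ne_zero_of_mulVec_eq_self (v := fun _ => 1) ?_ ?_ k)
    · exact fun h => one_ne_zero (congrFun h (Sum.inl ⟨0, hp⟩))
    · ext (i | i) <;> simp [X, Matrix.mulVec, dotProduct]
end

section
/- Let n ≥ 1, let V = V₀ ⊕ V₁ be a finite-dimensional ℤ₂-graded complex vector space, and let ρ be a ℂ-linear map from osp(1,2n) to End(V) such that ρ(X) preserves V₀ and V₁ whenever X is even, ρ(X) maps V₀ into V₁ and V₁ into V₀ whenever X is odd, and ρ(XY − (−1)^{|X||Y|}YX) = ρ(X)ρ(Y) − (−1)^{|X||Y|}ρ(Y)ρ(X) for all homogeneous X, Y ∈ osp(1,2n). Then for every odd X ∈ osp(1,2n), the operator ρ(X) is nilpotent. -/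
open Matrix

/-- In characteristic zero, an endomorphism `N` with `[A, N] = N` is nilpotent. -/
theorem Module.End.isNilpotent_of_mul_sub_mul_eq_self {K V : Type*} [Field K] [CharZero K]
    [AddCommGroup V] [Module K V] [FiniteDimensional K V] {A N : Module.End K V}
    (h : A * N - N * A = N) : IsNilpotent N := by
  have key (k : ℕ) : A * N ^ k - N ^ k * A = (k : K) • N ^ k := by
    induction k with
    | zero => simp
    | succ k ih =>
      calc A * N ^ (k + 1) - N ^ (k + 1) * A
          = (A * N ^ k - N ^ k * A) * N + N ^ k * (A * N - N * A) := by
            rw [pow_succ]; noncomm_ring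
        _ = ((k + 1 : ℕ) : K) • N ^ (k + 1) := by
            rw [ih, h, smul_mul_assoc, ← pow_succ]
            push_cast
            rw [add_smul, one_smul]
  by_contra hN
  let ad : Module.End K (Module.End K V) := LinearMap.mulLeft K A - LinearMap.mulRight K A
  have hev (k : ℕ) : ad.HasEigenvalue (k : K) :=
    Module.End.hasEigenvalue_of_hasEigenvector (x := N ^ k)
      ⟨Module.End.mem_eigenspace_iff.2 (key k), fun h0 => hN ⟨k, h0⟩⟩
  exact Set.infinite_of_injective_forall_mem (Nat.cast_injective (R := K)) hev
    ad.finite_hasEigenvalue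

theorem Bform_eq_dotProduct (n : ℕ) (u v : Idx 1 (2 * n) → ℂ) :
    Bform n u v = u ⬝ᵥ Bmat n *ᵥ v := by
  simp only [Bform, dotProduct, mulVec, Finset.mul_sum, mul_assoc]

/-- The form `B` is antisymmetric on odd vectors. -/
theorem Bmat_mulVec_of_odd {n : ℕ} {b : Idx 1 (2 * n) → ℂ} (hb : VHasParity b 1) :
    Bmat n *ᵥ b = -(b ᵥ* Bmat n) := by
  have hb0 (x) : b (Sum.inl x) = 0 := hb _ (by simp [ipar])
  funext i
  rcases i with i | i
  · simp [mulVec, vecMul, dotProduct, Bmat, hb0]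
  · simp only [mulVec, vecMul, dotProduct, Fintype.sum_sum_type, hb0, Pi.neg_apply, mul_zero,
      zero_mul, Finset.sum_const_zero, zero_add, ← Finset.sum_neg_distrib]
    refine Finset.sum_congr rfl fun j _ => ?_
    simp only [Bmat]
    have hi := i.isLt
    have hj := j.isLt
    split_ifs <;> first | omega | ring

/-- Left multiplication by the Gram matrix preserves oddness. -/
theorem VHasParity.vecMul_Bmat {n : ℕ} {b : Idx 1 (2 * n) → ℂ} (hb : VHasParity b 1) :
    VHasParity (b ᵥ* Bmat n) 1 := by
  rintro (i | i) hi
  · simp [vecMul, dotProduct, Bmat, hb (Sum.inl _) (by simp [ipar])]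
  · simp [ipar] at hi

/-- The even element `w ↦ B(c,w) b + B(b,w) c` of `osp(1,2n)` attached to odd vectors `b`, `c`. -/
noncomputable def ospEven {n : ℕ} (b c : Idx 1 (2 * n) → ℂ) :
    Matrix (Idx 1 (2 * n)) (Idx 1 (2 * n)) ℂ :=
  vecMulVec b (c ᵥ* Bmat n) + vecMulVec c (b ᵥ* Bmat n)

theorem ospMem_ospEven {n : ℕ} {b c : Idx 1 (2 * n) → ℂ} (hb : VHasParity b 1)
    (hc : VHasParity c 1) : ospMem (ospEven b c) 0 := by
  refine ⟨?_, fun u v εu εv _ _ => ?_⟩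
  · rintro (i | i) (j | j) h
    · simp [ipar] at h
    · simp [ospEven, vecMulVec_apply, hb (Sum.inl i) (by simp [ipar]),
        hc (Sum.inl i) (by simp [ipar])]
    · simp [ospEven, vecMulVec_apply, hb.vecMul_Bmat (Sum.inl j) (by simp [ipar]),
        hc.vecMul_Bmat (Sum.inl j) (by simp [ipar])]
    · simp [ipar] at h
  · have hs : sgn (0 * εu) = 1 := by simp [sgn]
    rw [hs, one_mul, Bform_eq_dotProduct, Bform_eq_dotProduct, ospEven, add_mulVec, add_mulVec,
      vecMulVec_mulVec, vecMulVec_mulVec, vecMulVec_mulVec, vecMulVec_mulVec]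
    simp only [mulVec_add, mulVec_smul, op_smul_eq_smul, add_dotProduct, smul_dotProduct,
      Bmat_mulVec_of_odd hb, Bmat_mulVec_of_odd hc, neg_dotProduct, smul_eq_mul,
      ← dotProduct_mulVec, dotProduct_comm u]
    ring

/-- The odd element `w ↦ B(e₀,w) b - B(b,w) e₀` of `osp(1,2n)` attached to an odd vector `b`. -/
noncomputable def ospOdd {n : ℕ} (b : Idx 1 (2 * n) → ℂ) :
    Matrix (Idx 1 (2 * n)) (Idx 1 (2 * n)) ℂ :=
  vecMulVec b (Pi.single (Sum.inl 0) 1) - vecMulVec (Pi.single (Sum.inl 0) 1) (b ᵥ* Bmat n)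

theorem ospMem.exists_eq_ospOdd {n : ℕ} {X : Matrix (Idx 1 (2 * n)) (Idx 1 (2 * n)) ℂ}
    (hX : ospMem X 1) : ∃ b, VHasParity b 1 ∧ X = ospOdd b := by
  have hb : VHasParity (X.col (Sum.inl 0)) 1 := fun i hi => hX.1 _ _ (by simpa [ipar] using hi)
  refine ⟨X.col (Sum.inl 0), hb, ?_⟩
  ext i j
  rcases i with i | i <;> rcases j with j | j
  · obtain rfl : i = 0 := Subsingleton.elim _ _
    obtain rfl : j = 0 := Subsingleton.elim _ _
    simp [ospOdd, vecMulVec_apply, hb.vecMul_Bmat (Sum.inl 0) (by simp [ipar]),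
      hX.1 (Sum.inl 0) (Sum.inl 0) (by simp [ipar])]
  · obtain rfl : i = 0 := Subsingleton.elim _ _
    have h := hX.2 (Pi.single (Sum.inl 0) 1) (Pi.single (Sum.inr j) 1) 0 1
      (by rintro (k | k) hk <;> simp_all [ipar])
      (by
        rintro (k | k) hk
        · simp
        · simp [ipar] at hk)
    have hrow (v : Idx 1 (2 * n) → ℂ) : (Bmat n *ᵥ v) (Sum.inl 0) = v (Sum.inl 0) := by
      simp [mulVec, dotProduct, Bmat]
    simp only [Bform_eq_dotProduct, mul_zero, sgn, zero_ne_one, if_false, one_mul,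
      single_one_dotProduct, hrow, mulVec_single_one] at h
    change (X.col (Sum.inl 0) ᵥ* Bmat n) (Sum.inr j) + X (Sum.inl 0) (Sum.inr j) = 0 at h
    simp only [ospOdd, Matrix.sub_apply, vecMulVec_apply, Pi.single_eq_same, one_mul, ne_eq,
      reduceCtorEq, not_false_eq_true, Pi.single_eq_of_ne, mul_zero, zero_sub]
    linear_combination h
  · obtain rfl : j = 0 := Subsingleton.elim _ _
    simp [ospOdd, vecMulVec_apply]
  · simp [ospOdd, vecMulVec_apply, hX.1 (Sum.inr i) (Sum.inr j) (by simp [ipar])]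

theorem commutator_ospEven_ospOdd {n : ℕ} {b c : Idx 1 (2 * n) → ℂ} (hb : VHasParity b 1)
    (hc : VHasParity c 1) :
    ospEven b c * ospOdd b - ospOdd b * ospEven b c = (c ᵥ* Bmat n ⬝ᵥ b) • ospOdd b := by
  have hb0 := hb (Sum.inl 0) (by simp [ipar])
  have hc0 := hc (Sum.inl 0) (by simp [ipar])
  have hbM0 := hb.vecMul_Bmat (Sum.inl 0) (by simp [ipar])
  have hcM0 := hc.vecMul_Bmat (Sum.inl 0) (by simp [ipar])
  have hbc : b ᵥ* Bmat n ⬝ᵥ c = -(c ᵥ* Bmat n ⬝ᵥ b) := by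
    rw [← dotProduct_mulVec, Bmat_mulVec_of_odd hc, dotProduct_neg, dotProduct_comm]
  have hbb : b ᵥ* Bmat n ⬝ᵥ b = 0 := by
    have : b ᵥ* Bmat n ⬝ᵥ b = -(b ᵥ* Bmat n ⬝ᵥ b) := by
      conv_lhs => rw [← dotProduct_mulVec, Bmat_mulVec_of_odd hb, dotProduct_neg, dotProduct_comm]
    exact self_eq_neg.1 this
  simp only [ospEven, ospOdd, add_mul, mul_add, sub_mul, mul_sub, vecMulVec_mul_vecMulVec,
    dotProduct_single_one, single_one_dotProduct, hb0, hc0, hbM0, hcM0, hbc, hbb, smul_sub]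
  simp [vecMulVec_smul]

theorem ospOdd_mul_self {n : ℕ} {b : Idx 1 (2 * n) → ℂ} (hb : VHasParity b 1)
    (h : b ᵥ* Bmat n = 0) : ospOdd b * ospOdd b = 0 := by
  simp [ospOdd, h, vecMulVec_mul_vecMulVec, hb (Sum.inl 0) (by simp [ipar])]

/-- If `ρ` is a (ℂ-linear) finite-dimensional representation of the Lie
superalgebra `osp(1,2n)` on a ℤ₂-graded space `V = V₀ ⊕ V₁` — i.e. `ρ X`
preserves the grading for even `X`, reverses it for odd `X`, and `ρ` carries
super brackets of homogeneous elements of `osp(1,2n)` to super commutators —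
then `ρ X` is nilpotent for every odd `X ∈ osp(1,2n)`. -/
theorem osp_odd_nilpotent_in_representation (n : ℕ) (hn : 1 ≤ n)
    (V : Type*) [AddCommGroup V] [Module ℂ V] [FiniteDimensional ℂ V]
    (V₀ V₁ : Submodule ℂ V) (hV : IsCompl V₀ V₁)
    (ρ : Matrix (Idx 1 (2*n)) (Idx 1 (2*n)) ℂ →ₗ[ℂ] Module.End ℂ V)
    (heven : ∀ X, ospMem X 0 →
      (∀ v ∈ V₀, ρ X v ∈ V₀) ∧ (∀ v ∈ V₁, ρ X v ∈ V₁))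
    (hodd : ∀ X, ospMem X 1 →
      (∀ v ∈ V₀, ρ X v ∈ V₁) ∧ (∀ v ∈ V₁, ρ X v ∈ V₀))
    (hbr : ∀ X Y (εX εY : ZMod 2), ospMem X εX → ospMem Y εY →
      ρ (X * Y - sgn (εX * εY) • (Y * X)) =
        ρ X * ρ Y - sgn (εX * εY) • (ρ Y * ρ X)) :
    ∀ X, ospMem X 1 → IsNilpotent (ρ X) := by
  intro X hX
  obtain ⟨b, hb, rfl⟩ := hX.exists_eq_ospOdd
  by_cases hbM : b ᵥ* Bmat n = 0
  · have h := hbr _ _ 1 1 hX hX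
    have hs : sgn (1 * 1) = -1 := by simp [sgn]
    rw [ospOdd_mul_self hb hbM, hs, smul_zero, sub_zero, map_zero, neg_smul, one_smul,
      sub_neg_eq_add, ← two_smul ℂ] at h
    exact ⟨2, by simpa [pow_two] using h.symm⟩
  · obtain ⟨k, hk⟩ := Function.ne_iff.1 hbM
    rcases k with k | k
    · exact absurd (hb.vecMul_Bmat (Sum.inl k) (by simp [ipar])) hk
    set t := (b ᵥ* Bmat n) (Sum.inr k) with ht
    let c : Idx 1 (2 * n) → ℂ := Pi.single (Sum.inr k) (-t⁻¹)
    have hc : VHasParity c 1 := by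
      rintro (i | i) hi
      · simp [c]
      · simp [ipar] at hi
    have hcb : c ᵥ* Bmat n ⬝ᵥ b = 1 := by
      rw [← dotProduct_mulVec, Bmat_mulVec_of_odd hb, dotProduct_neg, single_dotProduct, ← ht]
      simpa using inv_mul_cancel₀ hk
    have h := hbr _ _ 0 1 (ospMem_ospEven hb hc) hX
    have hs : sgn (0 * 1) = 1 := by simp [sgn]
    rw [hs, one_smul, one_smul, commutator_ospEven_ospOdd hb hc, hcb, one_smul] at h
    exact Module.End.isNilpotent_of_mul_sub_mul_eq_self h.symm
end

section
/- For all k ≥ 1 and all homogeneous matrices X₁, …, X_{2k} ∈ gl(p,q), the supertrace of the standard skew supersymmetric super polynomial of even order vanishes: str(𝒜_{2k}(X₁,…,X_{2k})) = 0. -/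
open Matrix

theorem sgn_sum {ι : Type*} (s : Finset ι) (f : ι → ZMod 2) :
    sgn (∑ i ∈ s, f i) = ∏ i ∈ s, sgn (f i) := by
  classical
  induction s using Finset.induction_on with
  | empty => simp [sgn]
  | insert a s ha ih => rw [Finset.sum_insert ha, Finset.prod_insert ha, sgn_add, ih]

theorem HasParity.one {p q : ℕ} : HasParity (1 : Matrix (Idx p q) (Idx p q) ℂ) 0 := by
  intro i j h
  rw [Matrix.one_apply_ne]
  rintro rfl
  simp at h

theorem HasParity.mul {p q : ℕ} {A B : Matrix (Idx p q) (Idx p q) ℂ} {a b : ZMod 2}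
    (hA : HasParity A a) (hB : HasParity B b) : HasParity (A * B) (a + b) := by
  intro i j h
  rw [Matrix.mul_apply]
  refine Finset.sum_eq_zero fun l _ => ?_
  by_cases h₁ : ipar i = ipar l + a
  · rw [hB l j, mul_zero]
    intro h₂
    apply h
    rw [h₁, h₂]
    ring
  · rw [hA i l h₁, zero_mul]

theorem HasParity.prod_ofFn {p q n : ℕ} (Y : Fin n → Matrix (Idx p q) (Idx p q) ℂ)
    (py : Fin n → ZMod 2) (hY : ∀ i, HasParity (Y i) (py i)) :
    HasParity (List.ofFn Y).prod (∑ i, py i) := by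
  induction n with
  | zero => simpa using HasParity.one
  | succ n ih =>
    rw [List.ofFn_succ, List.prod_cons, Fin.sum_univ_succ]
    exact (hY 0).mul (ih _ _ fun i => hY i.succ)

theorem strace_eq_sum {p q : ℕ} (X : Matrix (Idx p q) (Idx p q) ℂ) :
    strace X = ∑ i, sgn (ipar i) * X i i := by
  simp [strace, Fintype.sum_sum_type, ipar, sgn, sub_eq_add_neg]

theorem strace_sum_smul {p q : ℕ} {ι : Type*} (s : Finset ι) (c : ι → ℂ)
    (X : ι → Matrix (Idx p q) (Idx p q) ℂ) :
    strace (∑ i ∈ s, c i • X i) = ∑ i ∈ s, c i * strace (X i) := by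
  simp only [strace_eq_sum, Matrix.sum_apply, Matrix.smul_apply, smul_eq_mul, Finset.mul_sum]
  rw [Finset.sum_comm]
  exact Finset.sum_congr rfl fun _ _ => Finset.sum_congr rfl fun _ _ => by ring

/-- The supertrace is supercyclic. -/
theorem strace_mul_comm {p q : ℕ} {A B : Matrix (Idx p q) (Idx p q) ℂ} {a b : ZMod 2}
    (hA : HasParity A a) (hB : HasParity B b) :
    strace (B * A) = sgn (a * b) * strace (A * B) := by
  simp only [strace_eq_sum, Matrix.mul_apply, Finset.mul_sum]
  rw [Finset.sum_comm]
  refine Finset.sum_congr rfl fun i _ => Finset.sum_congr rfl fun j _ => ?_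
  by_cases h₁ : ipar i = ipar j + a
  · by_cases h₂ : ipar j = ipar i + b
    · have hs : sgn (ipar j) = sgn (a * b) * sgn (ipar i) := by
        rw [← sgn_add]
        have parity : ∀ x y a b : ZMod 2, x = y + a → y = x + b → y = a * b + x := by decide
        exact congrArg sgn (parity _ _ _ _ h₁ h₂)
      rw [hs]
      ring
    · rw [hB j i h₂]
      ring
  · rw [hA i j h₁]
    ring

theorem superSign_eq_prod {n : ℕ} (σ : Equiv.Perm (Fin n)) (px : Fin n → ZMod 2) :
    superSign σ px = ∏ i, ∏ j,
      if i < j ∧ σ j < σ i ∧ px (σ i) = 1 ∧ px (σ j) = 1 then (-1 : ℂ) else 1 := by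
  rw [superSign, ← Finset.prod_const, Finset.prod_filter, Fintype.prod_prod_type]

theorem superSign_mul_finRotate {m : ℕ} (σ : Equiv.Perm (Fin (m + 1)))
    (px : Fin (m + 1) → ZMod 2) :
    superSign (σ * finRotate (m + 1)) px =
      superSign σ px * sgn (px (σ 0) * ∑ j : Fin m, px (σ j.succ)) := by
  have first : superSign σ px =
      (∏ j : Fin m, if σ j.succ < σ 0 ∧ px (σ 0) = 1 ∧ px (σ j.succ) = 1 then (-1 : ℂ) else 1) *
      ∏ i : Fin m, ∏ j : Fin m, if i < j ∧ σ j.succ < σ i.succ ∧ px (σ i.succ) = 1 ∧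
        px (σ j.succ) = 1 then (-1 : ℂ) else 1 := by
    simp [superSign_eq_prod, Fin.prod_univ_succ]
  have last : superSign (σ * finRotate (m + 1)) px =
      (∏ i : Fin m, ∏ j : Fin m, if i < j ∧ σ j.succ < σ i.succ ∧ px (σ i.succ) = 1 ∧
        px (σ j.succ) = 1 then (-1 : ℂ) else 1) *
      ∏ j : Fin m, if σ 0 < σ j.succ ∧ px (σ j.succ) = 1 ∧ px (σ 0) = 1 then (-1 : ℂ) else 1 := by
    rw [← Finset.prod_mul_distrib]
    simp [superSign_eq_prod, Fin.prod_univ_castSucc, (Fin.castSucc_lt_last _).not_gt]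
  rw [first, last, Finset.mul_sum, sgn_sum, mul_right_comm, mul_comm]
  congr 1
  rw [← Finset.prod_mul_distrib]
  refine Finset.prod_congr rfl fun j _ => ?_
  have hne : σ j.succ ≠ σ 0 := fun h => Fin.succ_ne_zero j (σ.injective h)
  have key : ∀ x y : ZMod 2, x * y = 1 ↔ y = 1 ∧ x = 1 := by decide
  simp only [sgn, key]
  rcases lt_or_gt_of_ne hne with h | h <;>
    by_cases h₁ : px (σ 0) = 1 <;> by_cases h₂ : px (σ j.succ) = 1 <;>
    simp [h, h.not_gt, h₁, h₂]

theorem strace_permProd_mul_finRotate {m p q : ℕ} (σ : Equiv.Perm (Fin (m + 1)))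
    (X : Fin (m + 1) → Matrix (Idx p q) (Idx p q) ℂ) (px : Fin (m + 1) → ZMod 2)
    (hX : ∀ i, HasParity (X i) (px i)) :
    strace (permProd (σ * finRotate (m + 1)) X) =
      sgn (px (σ 0) * ∑ j : Fin m, px (σ j.succ)) * strace (permProd σ X) := by
  have h₁ : permProd σ X = X (σ 0) * (List.ofFn fun j : Fin m => X (σ j.succ)).prod := by
    rw [permProd, List.ofFn_succ, List.prod_cons]
  have h₂ : permProd (σ * finRotate (m + 1)) X =
      (List.ofFn fun j : Fin m => X (σ j.succ)).prod * X (σ 0) := by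
    rw [permProd, List.ofFn_succ', List.concat_eq_append, List.prod_append]
    simp
  rw [h₁, h₂]
  exact strace_mul_comm (hX _) (HasParity.prod_ofFn _ _ fun j => hX _)

theorem strace_skewPoly_eq_zero_of_even {n p q : ℕ} (hn : Even n) (hn₀ : n ≠ 0)
    (X : Fin n → Matrix (Idx p q) (Idx p q) ℂ) (px : Fin n → ZMod 2)
    (hX : ∀ i, HasParity (X i) (px i)) : strace (skewPoly X px) = 0 := by
  obtain ⟨m, rfl⟩ := Nat.exists_eq_succ_of_ne_zero hn₀
  have hm : Odd m := by
    rw [Nat.succ_eq_add_one, Nat.even_add_one] at hn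
    exact Nat.not_even_iff_odd.mp hn
  rw [skewPoly, strace_sum_smul, ← self_eq_neg, ← Finset.sum_neg_distrib]
  refine (Equiv.sum_comp (Equiv.mulRight (finRotate (m + 1))) _).symm.trans
    (Finset.sum_congr rfl fun σ _ => ?_)
  simp only [Equiv.coe_mulRight]
  rw [Equiv.Perm.sign_mul, sign_finRotate, Nat.succ_sub_one, hm.neg_one_pow,
    superSign_mul_finRotate, strace_permProd_mul_finRotate σ X px hX]
  push_cast
  linear_combination (-((Equiv.Perm.sign σ : ℤ) : ℂ) * superSign σ px * strace (permProd σ X)) *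
    sgn_mul_self (px (σ 0) * ∑ j : Fin m, px (σ j.succ))

/-- The supertrace of the standard skew supersymmetric super polynomial of even
order vanishes: `str (𝒜_{2k}(X₁,…,X_{2k})) = 0`. -/
theorem strace_skewPoly_even_eq_zero (p q k : ℕ) (hk : 1 ≤ k)
    (X : Fin (2*k) → Matrix (Idx p q) (Idx p q) ℂ)
    (px : Fin (2*k) → ZMod 2) (hX : ∀ i, HasParity (X i) (px i)) :
    strace (skewPoly X px) = 0 := by
  exact strace_skewPoly_eq_zero_of_even (even_two_mul k) (by omega) X px hX
end

section
/- For all k ≥ 1, every j with 0 ≤ j ≤ k, and all homogeneous matrices X₁, …, X_{2k+1} ∈ gl(p,q): Σ_{σ∈S_{2k+1}} ε(σ) ε(σ,𝒳) [X_{σ(1)},X_{σ(2)}] ⋯ [X_{σ(2j−1)},X_{σ(2j)}] · X_{σ(2j+1)} · [X_{σ(2j+2)},X_{σ(2j+3)}] ⋯ [X_{σ(2k)},X_{σ(2k+1)}] = 2^k · 𝒜_{2k+1}(X₁,…,X_{2k+1}), where the left-hand product consists of j super brackets, then the single factor X_{σ(2j+1)}, then k−j super brackets. -/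
open Matrix

open Equiv in
/-- Right multiplication by an adjacent transposition changes the super sign by the parity sign of
the two exchanged entries. -/
theorem superSign_mul_swap {n : ℕ} (σ : Perm (Fin n)) (px : Fin n → ZMod 2) (a b : Fin n)
    (hab : (a : ℕ) + 1 = b) :
    superSign (σ * swap a b) px = superSign σ px * sgn (px (σ a) * px (σ b)) := by
  classical
  have hne : a ≠ b := by rintro rfl; omega
  have hprod : ∀ τ : Perm (Fin n), superSign τ px = ∏ ij : Fin n × Fin n,
      if ij.1 < ij.2 ∧ τ ij.2 < τ ij.1 ∧ px (τ ij.1) = 1 ∧ px (τ ij.2) = 1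
        then (-1 : ℂ) else 1 := by
    intro τ
    rw [superSign, Finset.prod_ite, Finset.prod_const, Finset.prod_const_one, mul_one]
  let g : Fin n × Fin n → ℂ := fun ij =>
    if (ij = (a, b) ∨ ij = (b, a)) ∧ σ ij.2 < σ ij.1 ∧ px (σ ij.1) = 1 ∧ px (σ ij.2) = 1
      then -1 else 1
  have hg : ∏ ij, g ij = sgn (px (σ a) * px (σ b)) := by
    rw [Finset.prod_eq_mul (a, b) (b, a) (by simp [hne])
      (fun c _ hc => by simp [g, hc.1, hc.2]) (by simp) (by simp)]
    have hz : ∀ x y : ZMod 2, x * y = 1 ↔ x = 1 ∧ y = 1 := by decide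
    have hσ : σ a ≠ σ b := σ.injective.ne hne
    simp only [g, sgn, hz]
    rcases lt_or_gt_of_ne hσ with h | h <;> simp [h, h.not_gt, and_comm]
  rw [hprod, hprod, ← hg, ← Finset.prod_mul_distrib,
    ← Equiv.prod_comp ((swap a b).prodCongr (swap a b))]
  refine Finset.prod_congr rfl fun ⟨x, y⟩ _ => ?_
  simp only [prodCongr_apply, Prod.map, Perm.mul_apply, swap_apply_self, g, Prod.mk.injEq]
  by_cases hP : σ y < σ x ∧ px (σ x) = 1 ∧ px (σ y) = 1
  · have hxy : x ≠ y := by rintro rfl; exact lt_irrefl _ hP.1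
    simp only [hP, and_true]
    simp only [swap_apply_def, Fin.lt_def, Fin.ext_iff] at *
    split_ifs <;> first | omega | norm_num
  · simp [hP]

section SuperBracketSums

variable {n p q : ℕ} (X : Fin n → Matrix (Idx p q) (Idx p q) ℂ) (px : Fin n → ZMod 2)

/-- The coefficient `ε(σ) ε(σ,𝒳)`. -/
noncomputable def skewSign (σ : Equiv.Perm (Fin n)) : ℂ :=
  ((Equiv.Perm.sign σ : ℤ) : ℂ) * superSign σ px

/-- The matrix in position `i` after permuting by `σ`, with value `1` out of range. -/
noncomputable def permEntry (σ : Equiv.Perm (Fin n)) (i : ℕ) : Matrix (Idx p q) (Idx p q) ℂ :=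
  if h : i < n then X (σ ⟨i, h⟩) else 1

/-- The parity in position `i` after permuting by `σ`, with value `0` out of range. -/
def permParity (σ : Equiv.Perm (Fin n)) (i : ℕ) : ZMod 2 :=
  if h : i < n then px (σ ⟨i, h⟩) else 0

/-- The super bracket of the entries in positions `i` and `i + 1`. -/
noncomputable def permBracket (σ : Equiv.Perm (Fin n)) (i : ℕ) : Matrix (Idx p q) (Idx p q) ℂ :=
  sbr (permEntry X σ i) (permParity px σ i) (permEntry X σ (i + 1)) (permParity px σ (i + 1))

/-- The product of `m` consecutive super brackets, starting in position `s`. -/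
noncomputable def bracketProd (σ : Equiv.Perm (Fin n)) (s m : ℕ) : Matrix (Idx p q) (Idx p q) ℂ :=
  (List.ofFn fun l : Fin m => permBracket X px σ (s + 2 * l)).prod

/-- The product of `m` consecutive entries, starting in position `s`. -/
noncomputable def entryProd (σ : Equiv.Perm (Fin n)) (s m : ℕ) : Matrix (Idx p q) (Idx p q) ℂ :=
  (List.ofFn fun l : Fin m => permEntry X σ (s + l)).prod

theorem bracketProd_succ (σ : Equiv.Perm (Fin n)) (s m : ℕ) :
    bracketProd X px σ s (m + 1) = bracketProd X px σ s m * permBracket X px σ (s + 2 * m) := by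
  simp [bracketProd, List.ofFn_succ', List.concat_eq_append, -List.ofFn_succ]

theorem entryProd_succ (σ : Equiv.Perm (Fin n)) (s m : ℕ) :
    entryProd X σ s (m + 1) = entryProd X σ s m * permEntry X σ (s + m) := by
  simp [entryProd, List.ofFn_succ', List.concat_eq_append, -List.ofFn_succ]

theorem entryProd_add (σ : Equiv.Perm (Fin n)) (s m l : ℕ) :
    entryProd X σ s (m + l) = entryProd X σ s m * entryProd X σ (s + m) l := by
  induction l with
  | zero => simp [entryProd]
  | succ l ih => rw [← add_assoc, entryProd_succ, entryProd_succ, ih, mul_assoc, add_assoc]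

theorem permProd_eq_entryProd (σ : Equiv.Perm (Fin n)) :
    permProd σ X = entryProd X σ 0 n := by
  simp [permProd, entryProd, permEntry]

variable {X px}

theorem skewSign_mul_swap (σ : Equiv.Perm (Fin n)) {i : ℕ} (hi : i + 1 < n) :
    skewSign px (σ * Equiv.swap ⟨i, by omega⟩ ⟨i + 1, hi⟩) =
      -(skewSign px σ * sgn (permParity px σ i * permParity px σ (i + 1))) := by
  have hi' : i < n := by omega
  rw [skewSign, superSign_mul_swap σ px ⟨i, hi'⟩ ⟨i + 1, hi⟩ rfl, Equiv.Perm.sign_mul,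
    Equiv.Perm.sign_swap (by simp [Fin.ext_iff])]
  simp [skewSign, permParity, hi, hi', mul_assoc]

theorem permEntry_mul_swap_left (σ : Equiv.Perm (Fin n)) {i : ℕ} (hi : i + 1 < n) :
    permEntry X (σ * Equiv.swap ⟨i, by omega⟩ ⟨i + 1, hi⟩) i = permEntry X σ (i + 1) := by
  simp [permEntry, hi, (by omega : i < n)]

theorem permEntry_mul_swap_right (σ : Equiv.Perm (Fin n)) {i : ℕ} (hi : i + 1 < n) :
    permEntry X (σ * Equiv.swap ⟨i, by omega⟩ ⟨i + 1, hi⟩) (i + 1) = permEntry X σ i := by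
  simp [permEntry, hi, (by omega : i < n)]

theorem permEntry_mul_swap_of_ne (σ : Equiv.Perm (Fin n)) {i t : ℕ} (hi : i + 1 < n)
    (h : t ≠ i) (h' : t ≠ i + 1) :
    permEntry X (σ * Equiv.swap ⟨i, by omega⟩ ⟨i + 1, hi⟩) t = permEntry X σ t := by
  unfold permEntry
  split_ifs with ht
  · rw [Equiv.Perm.mul_apply, Equiv.swap_apply_of_ne_of_ne] <;> simpa [Fin.ext_iff]
  · rfl

theorem permParity_mul_swap_of_ne (σ : Equiv.Perm (Fin n)) {i t : ℕ} (hi : i + 1 < n)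
    (h : t ≠ i) (h' : t ≠ i + 1) :
    permParity px (σ * Equiv.swap ⟨i, by omega⟩ ⟨i + 1, hi⟩) t = permParity px σ t := by
  unfold permParity
  split_ifs with ht
  · rw [Equiv.Perm.mul_apply, Equiv.swap_apply_of_ne_of_ne] <;> simpa [Fin.ext_iff]
  · rfl

theorem bracketProd_mul_swap (σ : Equiv.Perm (Fin n)) {i s m : ℕ} (hi : i + 1 < n)
    (h : i + 1 < s ∨ s + 2 * m ≤ i) :
    bracketProd X px (σ * Equiv.swap ⟨i, by omega⟩ ⟨i + 1, hi⟩) s m =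
      bracketProd X px σ s m := by
  refine congrArg (fun f => (List.ofFn f).prod) (funext fun l => ?_)
  unfold permBracket
  rw [permEntry_mul_swap_of_ne, permEntry_mul_swap_of_ne, permParity_mul_swap_of_ne,
    permParity_mul_swap_of_ne] <;> omega

theorem entryProd_mul_swap (σ : Equiv.Perm (Fin n)) {i s m : ℕ} (hi : i + 1 < n)
    (h : i + 1 < s ∨ s + m ≤ i) :
    entryProd X (σ * Equiv.swap ⟨i, by omega⟩ ⟨i + 1, hi⟩) s m = entryProd X σ s m := by
  refine congrArg (fun f => (List.ofFn f).prod) (funext fun l => ?_)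
  exact permEntry_mul_swap_of_ne _ _ (by omega) (by omega)

/-- Inside a signed sum over permutations a super bracket may be replaced by twice the product. -/
theorem sum_mul_permBracket_mul {i : ℕ} (hi : i + 1 < n)
    (L R : Equiv.Perm (Fin n) → Matrix (Idx p q) (Idx p q) ℂ)
    (hL : ∀ σ, L (σ * Equiv.swap ⟨i, by omega⟩ ⟨i + 1, hi⟩) = L σ)
    (hR : ∀ σ, R (σ * Equiv.swap ⟨i, by omega⟩ ⟨i + 1, hi⟩) = R σ) :
    ∑ σ, skewSign px σ • (L σ * permBracket X px σ i * R σ) =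
      (2 : ℂ) • ∑ σ, skewSign px σ • (L σ * entryProd X σ i 2 * R σ) := by
  have hexp : ∀ σ, skewSign px σ • (L σ * permBracket X px σ i * R σ) =
      skewSign px σ • (L σ * entryProd X σ i 2 * R σ) +
        skewSign px (σ * Equiv.swap ⟨i, by omega⟩ ⟨i + 1, hi⟩) •
          (L (σ * Equiv.swap ⟨i, by omega⟩ ⟨i + 1, hi⟩) *
            entryProd X (σ * Equiv.swap ⟨i, by omega⟩ ⟨i + 1, hi⟩) i 2 *
            R (σ * Equiv.swap ⟨i, by omega⟩ ⟨i + 1, hi⟩)) := by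
    intro σ
    have he : ∀ τ, entryProd X τ i 2 = permEntry X τ i * permEntry X τ (i + 1) := fun τ => by
      simp [entryProd, List.ofFn_succ]
    rw [hL, hR, skewSign_mul_swap, he, he, permEntry_mul_swap_left, permEntry_mul_swap_right,
      permBracket, sbr, mul_sub, sub_mul, smul_sub, mul_smul_comm, smul_mul_assoc, smul_smul,
      neg_smul, sub_eq_add_neg]
  rw [Finset.sum_congr rfl fun σ _ => hexp σ, Finset.sum_add_distrib, two_smul]
  exact congrArg _ (Equiv.sum_comp (Equiv.mulRight (Equiv.swap ⟨i, by omega⟩ ⟨i + 1, hi⟩))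
    fun σ => skewSign px σ • (L σ * entryProd X σ i 2 * R σ))

theorem sum_mul_bracketProd_mul (s m : ℕ) (hm : s + 2 * m ≤ n)
    (L R : Equiv.Perm (Fin n) → Matrix (Idx p q) (Idx p q) ℂ)
    (hL : ∀ σ i, ∀ hi : i + 1 < n, s ≤ i → i + 1 < s + 2 * m →
      L (σ * Equiv.swap ⟨i, by omega⟩ ⟨i + 1, hi⟩) = L σ)
    (hR : ∀ σ i, ∀ hi : i + 1 < n, s ≤ i → i + 1 < s + 2 * m →
      R (σ * Equiv.swap ⟨i, by omega⟩ ⟨i + 1, hi⟩) = R σ) :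
    ∑ σ, skewSign px σ • (L σ * bracketProd X px σ s m * R σ) =
      (2 : ℂ) ^ m • ∑ σ, skewSign px σ • (L σ * entryProd X σ s (2 * m) * R σ) := by
  induction m generalizing R with
  | zero => simp [bracketProd, entryProd]
  | succ m ih =>
    have h := sum_mul_permBracket_mul (X := X) (px := px) (i := s + 2 * m) (by omega)
      (fun σ => L σ * bracketProd X px σ s m) R
      (fun σ => by rw [hL _ _ _ (by omega) (by omega), bracketProd_mul_swap _ _ (by omega)])
      (fun σ => hR _ _ _ (by omega) (by omega))
    have h' := ih (by omega) (fun σ => entryProd X σ (s + 2 * m) 2 * R σ)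
      (fun σ i hi h₁ h₂ => hL σ i hi h₁ (by omega))
      (fun σ i hi h₁ h₂ => by
        rw [hR σ i hi h₁ (by omega), entryProd_mul_swap _ _ (by omega)])
    simp only [← mul_assoc] at h h'
    simp only [bracketProd_succ, mul_add_one 2 m, entryProd_add, ← mul_assoc]
    rw [h, h', smul_smul, pow_succ']

end SuperBracketSums

/-- `Σ_σ ε(σ) ε(σ,𝒳) [X_{σ(1)},X_{σ(2)}] ⋯ [X_{σ(2j-1)},X_{σ(2j)}] ⬝ X_{σ(2j+1)} ⬝
[X_{σ(2j+2)},X_{σ(2j+3)}] ⋯ [X_{σ(2k)},X_{σ(2k+1)}] = 2^k ⬝ 𝒜_{2k+1}(X₁,…,X_{2k+1})`: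
`j` super brackets, then a single factor, then `k - j` super brackets. -/
theorem sum_bracket_prod_eq_skewPoly_odd (p q k : ℕ) (hk : 1 ≤ k)
    (j : ℕ) (hj : j ≤ k)
    (X : Fin (2*k+1) → Matrix (Idx p q) (Idx p q) ℂ)
    (px : Fin (2*k+1) → ZMod 2) (hX : ∀ i, HasParity (X i) (px i)) :
    ∑ σ : Equiv.Perm (Fin (2*k+1)),
      (((Equiv.Perm.sign σ : ℤ) : ℂ) * superSign σ px) •
        ((List.ofFn fun l : Fin j =>
            sbr (X (σ ⟨2*l.val, by have := l.isLt; omega⟩))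
                (px (σ ⟨2*l.val, by have := l.isLt; omega⟩))
                (X (σ ⟨2*l.val+1, by have := l.isLt; omega⟩))
                (px (σ ⟨2*l.val+1, by have := l.isLt; omega⟩))) ++
         [X (σ ⟨2*j, by omega⟩)] ++
         (List.ofFn fun l : Fin (k-j) =>
            sbr (X (σ ⟨2*j+1+2*l.val, by have := l.isLt; omega⟩))
                (px (σ ⟨2*j+1+2*l.val, by have := l.isLt; omega⟩))
                (X (σ ⟨2*j+2+2*l.val, by have := l.isLt; omega⟩))
                (px (σ ⟨2*j+2+2*l.val, by have := l.isLt; omega⟩)))).prod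
      = (2:ℂ)^k • skewPoly X px := by
  have hprod : ∀ σ : Equiv.Perm (Fin (2*k+1)), permProd σ X =
      entryProd X σ 0 (2*j) * entryProd X σ (2*j) 1 * entryProd X σ (2*j+1) (2*(k-j)) := by
    intro σ
    have hlen := entryProd_add X σ 0 (2*j + 1) (2*(k-j))
    rwa [show 2*j + 1 + 2*(k-j) = 2*k+1 by omega, ← permProd_eq_entryProd,
      entryProd_add, zero_add, zero_add] at hlen
  have hleft := sum_mul_bracketProd_mul (X := X) (px := px) 0 j (by omega) (fun _ => 1)
    (fun σ => entryProd X σ (2*j) 1 * bracketProd X px σ (2*j+1) (k-j)) (fun _ _ _ _ _ => rfl)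
    (fun σ i hi _ h => by
      rw [entryProd_mul_swap _ _ (by omega), bracketProd_mul_swap _ _ (by omega)])
  have hright := sum_mul_bracketProd_mul (X := X) (px := px) (2*j+1) (k-j) (by omega)
    (fun σ => entryProd X σ 0 (2*j) * entryProd X σ (2*j) 1) (fun _ => 1)
    (fun σ i hi h _ => by
      rw [entryProd_mul_swap _ _ (by omega), entryProd_mul_swap _ _ (by omega)])
    (fun _ _ _ _ _ => rfl)
  simp only [one_mul, mul_one, ← mul_assoc] at hleft hright
  rw [hright, smul_smul, ← pow_add, Nat.add_sub_cancel' hj] at hleft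
  simp only [skewPoly, hprod]
  refine Eq.trans (Finset.sum_congr rfl fun σ _ => congrArg _ ?_) hleft
  have hbracket : ∀ s m (h : s + 2*m ≤ 2*k+1), bracketProd X px σ s m =
      (List.ofFn fun l : Fin m => sbr
        (X (σ ⟨s+2*l.val, by omega⟩)) (px (σ ⟨s+2*l.val, by omega⟩))
        (X (σ ⟨s+2*l.val+1, by omega⟩)) (px (σ ⟨s+2*l.val+1, by omega⟩))).prod := by
    intro s m h
    refine congrArg (fun f => (List.ofFn f).prod) (funext fun l => ?_)
    have h₁ : s + 2*l.val < 2*k+1 := by omega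
    have h₂ : s + 2*l.val + 1 < 2*k+1 := by omega
    simp only [permBracket, permEntry, permParity, dif_pos h₁, dif_pos h₂]
  have hsingle : entryProd X σ (2*j) 1 = X (σ ⟨2*j, by omega⟩) := by
    simp [entryProd, permEntry, hj]
  rw [hbracket 0 j (by omega), hbracket (2*j+1) (k-j) (by omega), hsingle, List.prod_append,
    List.prod_append, List.prod_singleton]
  simp only [zero_add, add_right_comm _ _ 1]
end
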